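/- arXiv:2305.15034 — 4 statements merged into one kernel-verified Lean document; each statement's English description precedes it below -/
import Mathlib

section
/- For every θ ≥ 0, the function r_θ solves the resolvent equation associated with the kernel l: r_θ(t) + θ (r_θ ∗ l)(t) = l(t) for every t > 0. -/
open MeasureTheory Real

/-- `μ` is a nonzero distributed-order measure supported in `(0,1]`: it has the form
`Σₙ qₙ δ_{αₙ} + w·(Lebesgue on (0,1))` with `0 < α₁ < ⋯ < α_M < 1`, `qₙ ≥ 0`, and a
nonnegative weight `w ∈ L¹((0,1))` (either part may vanish, but `μ ≠ 0`). -/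
def IsDistOrderMeasure (μ : Measure ℝ) : Prop :=
  μ ≠ 0 ∧
  ∃ (M : ℕ) (α : Fin M → ℝ) (q : Fin M → ℝ) (w : ℝ → ℝ),
    StrictMono α ∧ (∀ n, α n ∈ Set.Ioo (0:ℝ) 1) ∧ (∀ n, 0 ≤ q n) ∧
    (∀ x ∈ Set.Ioo (0:ℝ) 1, 0 ≤ w x) ∧
    MeasureTheory.IntegrableOn w (Set.Ioo 0 1) ∧
    μ = (∑ n, ENNReal.ofReal (q n) • MeasureTheory.Measure.dirac (α n)) +
        ((MeasureTheory.volume.restrict (Set.Ioo (0:ℝ) 1)).withDensity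
          fun x => ENNReal.ofReal (w x))

/-- The kernel `k(t) = ∫_{(0,1]} t^{−α}/Γ(1−α) dμ(α)`. -/
noncomputable def kker (μ : Measure ℝ) (t : ℝ) : ℝ :=
  ∫ a in Set.Ioc (0:ℝ) 1, t ^ (-a) / Real.Gamma (1 - a) ∂μ

/-- `H(r)` from the representation formula for the kernel `l`. -/
noncomputable def Hker (μ : Measure ℝ) (r : ℝ) : ℝ :=
  (∫ a in Set.Ioc (0:ℝ) 1, r ^ a * Real.sin (Real.pi * a) ∂μ) /
    ((∫ a in Set.Ioc (0:ℝ) 1, r ^ a * Real.sin (Real.pi * a) ∂μ) ^ 2 +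
     (∫ a in Set.Ioc (0:ℝ) 1, r ^ a * Real.cos (Real.pi * a) ∂μ) ^ 2)

/-- The kernel `l(t) = (1/π) ∫₀^∞ e^{−rt} H(r) dr`. -/
noncomputable def lker (μ : Measure ℝ) (t : ℝ) : ℝ :=
  (1 / Real.pi) * ∫ r in Set.Ioi (0:ℝ), Real.exp (-(r * t)) * Hker μ r

/-- The resolvent-type kernel `r_θ(t) = (1/π) ∫₀^∞ e^{−pt} H_θ(p) dp`, where
`H_θ(p) = S(p) / (S(p)² + (θ + C(p))²)` with `S(p) = ∫_{(0,1]} p^α sin(πα) dμ(α)` and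
`C(p) = ∫_{(0,1]} p^α cos(πα) dμ(α)`. -/
noncomputable def rtheta (μ : Measure ℝ) (θ : ℝ) (t : ℝ) : ℝ :=
  (1 / Real.pi) * ∫ p in Set.Ioi (0:ℝ), Real.exp (-(p * t)) *
    ((∫ a in Set.Ioc (0:ℝ) 1, p ^ a * Real.sin (Real.pi * a) ∂μ) /
      ((∫ a in Set.Ioc (0:ℝ) 1, p ^ a * Real.sin (Real.pi * a) ∂μ) ^ 2 +
       (θ + ∫ a in Set.Ioc (0:ℝ) 1, p ^ a * Real.cos (Real.pi * a) ∂μ) ^ 2))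

open ProbabilityTheory Filter Topology

section Symbol

variable {ν : Measure ℝ}

lemma integrable_exp_mul_of_ae_mem_Ioo [IsFiniteMeasure ν] (hν : ∀ᵐ a ∂ν, a ∈ Set.Ioo (0:ℝ) 1)
    (x : ℝ) : Integrable (fun a => rexp (x * a)) ν := by
  refine Integrable.of_bound (by fun_prop) (rexp |x|) ?_
  filter_upwards [hν] with a ha
  rw [Real.norm_eq_abs, abs_of_pos (exp_pos _), exp_le_exp]
  calc x * a ≤ |x| * a := by gcongr; exacts [ha.1.le, le_abs_self x]
    _ ≤ |x| * 1 := by gcongr; exact ha.2.le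
    _ = |x| := mul_one _

lemma integrable_exp_mul_mul_of_bounded [IsFiniteMeasure ν]
    (hν : ∀ᵐ a ∂ν, a ∈ Set.Ioo (0:ℝ) 1) (x : ℝ) {g : ℝ → ℝ} (hg : Measurable g) {c : ℝ}
    (hc : ∀ a ∈ Set.Ioo (0:ℝ) 1, |g a| ≤ c) : Integrable (fun a => rexp (x * a) * g a) ν := by
  refine (integrable_exp_mul_of_ae_mem_Ioo hν x).mul_bdd (c := c) hg.aestronglyMeasurable ?_
  filter_upwards [hν] with a ha using hc a ha

lemma differentiable_complexMGF_of_ae_mem_Ioo [IsFiniteMeasure ν]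
    (hν : ∀ᵐ a ∂ν, a ∈ Set.Ioo (0:ℝ) 1) : Differentiable ℂ (complexMGF id ν) := by
  intro z
  have huniv : integrableExpSet id ν = Set.univ := by
    ext x
    simpa [integrableExpSet] using integrable_exp_mul_of_ae_mem_Ioo hν x
  exact (hasDerivAt_complexMGF (by simp [huniv])).differentiableAt

lemma integrable_cexp_mul [IsFiniteMeasure ν]
    (hν : ∀ᵐ a ∂ν, a ∈ Set.Ioo (0:ℝ) 1) (z : ℂ) :
    Integrable (fun a : ℝ => Complex.exp (z * a)) ν := by
  refine (integrable_exp_mul_of_ae_mem_Ioo hν z.re).mono' (by fun_prop) ?_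
  filter_upwards with a
  simp [Complex.norm_exp]

/-- The boundary sine symbol of `ν` in the logarithmic variable. -/
noncomputable def sinSymbol (ν : Measure ℝ) (x : ℝ) : ℝ := ∫ a, rexp (x * a) * sin (π * a) ∂ν

lemma sin_pi_mul_pos {a : ℝ} (ha : a ∈ Set.Ioo (0:ℝ) 1) : 0 < sin (π * a) :=
  sin_pos_of_pos_of_lt_pi (by have := ha.1; positivity) (by nlinarith [pi_pos, ha.2])

lemma integral_pos_of_ae_mem_Ioo (hν : ∀ᵐ a ∂ν, a ∈ Set.Ioo (0:ℝ) 1) (h0 : ν ≠ 0)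
    {g : ℝ → ℝ} (hg : Integrable g ν) (hpos : ∀ a ∈ Set.Ioo (0:ℝ) 1, 0 < g a) :
    0 < ∫ a, g a ∂ν := by
  have hge : 0 ≤ᵐ[ν] g := by filter_upwards [hν] with a ha using (hpos a ha).le
  rw [integral_pos_iff_support_of_nonneg_ae hge hg, pos_iff_ne_zero]
  intro hs
  apply h0
  rw [← ae_eq_bot, ← empty_mem_iff_bot]
  have hs' : ∀ᵐ a ∂ν, a ∉ Function.support g := measure_eq_zero_iff_ae_notMem.1 hs
  filter_upwards [hν, hs'] with a ha hga
  exact hga (hpos a ha).ne'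

lemma sinSymbol_pos [IsFiniteMeasure ν] (hν : ∀ᵐ a ∂ν, a ∈ Set.Ioo (0:ℝ) 1) (h0 : ν ≠ 0)
    (x : ℝ) : 0 < sinSymbol ν x :=
  integral_pos_of_ae_mem_Ioo hν h0
    (integrable_exp_mul_mul_of_bounded hν x (by fun_prop) fun a _ => abs_sin_le_one _)
    fun a ha => mul_pos (exp_pos _) (sin_pi_mul_pos ha)

lemma exists_mul_le_sinSymbol [IsFiniteMeasure ν] (hν : ∀ᵐ a ∂ν, a ∈ Set.Ioo (0:ℝ) 1)
    (h0 : ν ≠ 0) :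
    ∃ c > 0, ∀ x : ℝ, c * x ≤ sinSymbol ν x ∧ c * x ≤ rexp x * sinSymbol ν (-x) := by
  have hi : ∀ {g : ℝ → ℝ}, Measurable g → (∀ a ∈ Set.Ioo (0:ℝ) 1, |g a| ≤ 1) →
      Integrable g ν := fun hg hb => by
    simpa using integrable_exp_mul_mul_of_bounded hν 0 hg hb
  have h1 : Integrable (fun a => a * (1 - a) * sin (π * a)) ν := by
    refine hi (by fun_prop) fun a ha => ?_
    rw [abs_mul, abs_of_pos (mul_pos ha.1 (sub_pos.2 ha.2))]
    refine mul_le_one₀ ?_ (abs_nonneg _) (abs_sin_le_one _)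
    nlinarith [ha.1, ha.2]
  refine ⟨∫ a, a * (1 - a) * sin (π * a) ∂ν, integral_pos_of_ae_mem_Ioo hν h0 h1 fun a ha =>
    mul_pos (mul_pos ha.1 (sub_pos.2 ha.2)) (sin_pi_mul_pos ha), fun x => ?_⟩
  have hS : ∀ y, Integrable (fun a => rexp (y * a) * sin (π * a)) ν := fun y =>
    integrable_exp_mul_mul_of_bounded hν y (by fun_prop) fun a _ => abs_sin_le_one _
  have key : ∀ a ∈ Set.Ioo (0:ℝ) 1, a * (1 - a) * x ≤ rexp (x * a) := fun a ha => by
    rcases le_total 0 x with hx | hx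
    · nlinarith [add_one_le_exp (x * a), mul_nonneg (mul_nonneg ha.1.le ha.1.le) hx]
    · nlinarith [exp_pos (x * a), mul_pos ha.1 (sub_pos.2 ha.2)]
  constructor
  · rw [← integral_mul_const]
    refine integral_mono_ae (h1.mul_const _) (hS x) ?_
    filter_upwards [hν] with a ha
    nlinarith [key a ha, sin_pi_mul_pos ha]
  · rw [← integral_mul_const, sinSymbol, ← integral_const_mul]
    refine integral_mono_ae (h1.mul_const _) ((hS _).const_mul _) ?_
    filter_upwards [hν] with a ha
    have h := key (1 - a) ⟨by linarith [ha.2], by linarith [ha.1]⟩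
    have he : rexp x * rexp (-x * a) = rexp (x * (1 - a)) := by rw [← Real.exp_add]; ring_nf
    simp only [← mul_assoc, he]
    nlinarith [sin_pi_mul_pos ha]

lemma sinSymbol_le_norm [IsFiniteMeasure ν] (hν : ∀ᵐ a ∂ν, a ∈ Set.Ioo (0:ℝ) 1) {θ : ℝ}
    (hθ : 0 ≤ θ) {z : ℂ} (hz : |z.im| ≤ π) : sinSymbol ν z.re ≤ ‖θ + complexMGF id ν z‖ := by
  have hrot : (Complex.exp (-(z.im / 2 : ℝ) * Complex.I) * (θ + complexMGF id ν z)).re =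
      θ * cos (z.im / 2) + ∫ a, rexp (z.re * a) * cos ((a - 1 / 2) * z.im) ∂ν := by
    simp only [complexMGF, id]
    rw [mul_add, ← integral_const_mul, Complex.add_re, ← Complex.reCLM_apply (∫ _, _ ∂_),
      ← ContinuousLinearMap.integral_comp_comm _ ((integrable_cexp_mul hν z).const_mul _)]
    congr 1
    · rw [mul_comm, Complex.re_ofReal_mul, ← Complex.ofReal_neg, Complex.exp_ofReal_mul_I_re,
        cos_neg]
    · refine integral_congr_ae (.of_forall fun a => ?_)
      simp only [Complex.reCLM_apply, ← Complex.exp_add, Complex.exp_re]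
      congr 2
      · simp
      · simp; ring
  have hnorm : ‖θ + complexMGF id ν z‖ =
      ‖Complex.exp (-(z.im / 2 : ℝ) * Complex.I) * (θ + complexMGF id ν z)‖ := by
    rw [norm_mul, ← Complex.ofReal_neg, Complex.norm_exp_ofReal_mul_I, one_mul]
  rw [hnorm]
  refine le_trans ?_ (Complex.re_le_norm _)
  rw [hrot]
  obtain ⟨hz1, hz2⟩ := abs_le.1 hz
  have hcos : 0 ≤ θ * cos (z.im / 2) :=
    mul_nonneg hθ (cos_nonneg_of_mem_Icc ⟨by linarith, by linarith⟩)
  refine le_add_of_nonneg_of_le hcos ?_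
  refine integral_mono_ae
    (integrable_exp_mul_mul_of_bounded hν _ (by fun_prop) fun a _ => abs_sin_le_one _)
    (integrable_exp_mul_mul_of_bounded hν _ (by fun_prop) fun a _ => abs_cos_le_one _) ?_
  filter_upwards [hν] with a ha
  gcongr
  have hs : sin (π * a) = cos (|a - 1 / 2| * π) := by
    rw [← abs_of_pos pi_pos, ← abs_mul, cos_abs, ← cos_pi_div_two_sub, abs_of_pos pi_pos, ← cos_neg]
    ring_nf
  rw [hs, ← cos_abs ((a - 1 / 2) * z.im), abs_mul]
  have ha' : |a - 1 / 2| ≤ 1 := abs_le.2 ⟨by linarith [ha.1], by linarith [ha.2]⟩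
  refine cos_le_cos_of_nonneg_of_le_pi (by positivity) ?_ (by gcongr)
  nlinarith [pi_pos]

end Symbol

section Stieltjes

open Complex (I)

variable {ν : Measure ℝ}

/-- The resolvent symbol `1 / (θ + ∫ z^a dν(a))` at `z = exp ζ`. -/
noncomputable def resolventSymbol (ν : Measure ℝ) (θ : ℝ) (ζ : ℂ) : ℂ :=
  (θ + complexMGF id ν ζ)⁻¹

/-- The Stieltjes quotient of the resolvent symbol at the point `exp b`, with the removable
singularity at `b` filled in. -/
noncomputable def stieltjesQuotient (ν : Measure ℝ) (θ b : ℝ) (ζ : ℂ) : ℂ :=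
  dslope (resolventSymbol ν θ) b ζ / dslope Complex.exp b ζ * Complex.exp ζ

lemma stieltjesQuotient_of_ne (θ : ℝ) {b : ℝ} {ζ : ℂ} (h : ζ ≠ b) :
    stieltjesQuotient ν θ b ζ = (resolventSymbol ν θ ζ - resolventSymbol ν θ b) /
      (Complex.exp ζ - Complex.exp b) * Complex.exp ζ := by
  have h' : ζ - b ≠ 0 := sub_ne_zero.2 h
  rw [stieltjesQuotient, dslope_of_ne _ h, dslope_of_ne _ h, slope_def_field, slope_def_field,
    div_div_div_cancel_right₀ h']

lemma exp_ne_of_abs_im_le_pi {b : ℝ} {ζ : ℂ} (h : ζ ≠ b) (hζ : |ζ.im| ≤ π) :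
    Complex.exp ζ - Complex.exp b ≠ 0 := by
  rw [sub_ne_zero]
  intro he
  obtain ⟨n, hn⟩ := Complex.exp_eq_exp_iff_exists_int.1 he
  have him : ζ.im = n * (2 * π) := by simpa using congrArg Complex.im hn
  have hn0 : n = 0 := by
    rw [him, abs_mul, abs_of_pos two_pi_pos] at hζ
    have : |(n : ℝ)| < 1 := by
      by_contra! hc
      nlinarith [pi_pos]
    exact Int.abs_lt_one_iff.1 (by exact_mod_cast this)
  exact h (by simpa [hn0] using hn)

lemma resolventSymbol_differentiableAt [IsFiniteMeasure ν]
    (hν : ∀ᵐ a ∂ν, a ∈ Set.Ioo (0:ℝ) 1) (h0 : ν ≠ 0) {θ : ℝ} (hθ : 0 ≤ θ) {ζ : ℂ}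
    (hζ : |ζ.im| ≤ π) : DifferentiableAt ℂ (resolventSymbol ν θ) ζ := by
  refine ((differentiableAt_const _).add
    (differentiable_complexMGF_of_ae_mem_Ioo hν ζ)).inv ?_
  exact norm_pos_iff.1 ((sinSymbol_pos hν h0 _).trans_le (sinSymbol_le_norm hν hθ hζ))

lemma norm_resolventSymbol_le [IsFiniteMeasure ν]
    (hν : ∀ᵐ a ∂ν, a ∈ Set.Ioo (0:ℝ) 1) (h0 : ν ≠ 0) {θ : ℝ} (hθ : 0 ≤ θ) {ζ : ℂ}
    (hζ : |ζ.im| ≤ π) : ‖resolventSymbol ν θ ζ‖ ≤ (sinSymbol ν ζ.re)⁻¹ := by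
  rw [resolventSymbol, norm_inv]
  exact inv_anti₀ (sinSymbol_pos hν h0 _) (sinSymbol_le_norm hν hθ hζ)

lemma stieltjesQuotient_continuousOn [IsFiniteMeasure ν]
    (hν : ∀ᵐ a ∂ν, a ∈ Set.Ioo (0:ℝ) 1) (h0 : ν ≠ 0) {θ : ℝ} (hθ : 0 ≤ θ) (b : ℝ) :
    ContinuousOn (stieltjesQuotient ν θ b) {ζ | |ζ.im| ≤ π} := by
  have hb : {ζ : ℂ | |ζ.im| ≤ π} ∈ 𝓝 (b : ℂ) := by
    refine mem_of_superset ((isOpen_lt (by fun_prop : Continuous fun ζ : ℂ => |ζ.im|)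
      continuous_const).mem_nhds (by simp [pi_pos] : |(b : ℂ).im| < π)) ?_
    exact fun ζ (hζ : |ζ.im| < π) => hζ.le
  refine ContinuousOn.mul (ContinuousOn.div ((continuousOn_dslope hb).2
    ⟨fun ζ hζ => (resolventSymbol_differentiableAt hν h0 hθ hζ).continuousAt.continuousWithinAt,
      resolventSymbol_differentiableAt hν h0 hθ (by simp [pi_pos.le])⟩)
    ((continuousOn_dslope hb).2 ⟨by fun_prop, by fun_prop⟩) fun ζ hζ => ?_) (by fun_prop)
  rcases eq_or_ne ζ b with rfl | h
  · simp
  · rw [dslope_of_ne _ h, slope_def_field]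
    exact div_ne_zero (exp_ne_of_abs_im_le_pi h hζ) (sub_ne_zero.2 h)

lemma stieltjesQuotient_differentiableAt [IsFiniteMeasure ν]
    (hν : ∀ᵐ a ∂ν, a ∈ Set.Ioo (0:ℝ) 1) (h0 : ν ≠ 0) {θ : ℝ} (hθ : 0 ≤ θ) {b : ℝ} {ζ : ℂ}
    (hζ : |ζ.im| ≤ π) (h : ζ ≠ b) : DifferentiableAt ℂ (stieltjesQuotient ν θ b) ζ := by
  refine DifferentiableAt.mul (DifferentiableAt.div ((differentiableAt_dslope_of_ne h).2
    (resolventSymbol_differentiableAt hν h0 hθ hζ)) ((differentiableAt_dslope_of_ne h).2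
    (by fun_prop)) ?_) (by fun_prop)
  rw [dslope_of_ne _ h, slope_def_field]
  exact div_ne_zero (exp_ne_of_abs_im_le_pi h hζ) (sub_ne_zero.2 h)

lemma integral_boundary_stieltjesQuotient [IsFiniteMeasure ν]
    (hν : ∀ᵐ a ∂ν, a ∈ Set.Ioo (0:ℝ) 1) (h0 : ν ≠ 0) {θ : ℝ} (hθ : 0 ≤ θ) (b R : ℝ) :
    ∫ x in -R..R, (stieltjesQuotient ν θ b (x - π * I) - stieltjesQuotient ν θ b (x + π * I)) =
      I * (∫ y in -π..π, stieltjesQuotient ν θ b (-R + y * I)) -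
      I * ∫ y in -π..π, stieltjesQuotient ν θ b (R + y * I) := by
  have hcont := stieltjesQuotient_continuousOn hν h0 hθ b
  have hpi : -π ≤ π := by linarith [pi_pos]
  have hc : ∀ {y : ℝ}, |y| ≤ π → ContinuousOn
      (fun x : ℝ => stieltjesQuotient ν θ b (x + y * I)) Set.univ := fun hy =>
    hcont.comp (by fun_prop) (fun x _ => by simpa using hy)
  have hint : ∀ {y : ℝ}, |y| ≤ π → IntervalIntegrable
      (fun x : ℝ => stieltjesQuotient ν θ b (x + y * I)) volume (-R) R := fun hy =>
    (continuousOn_univ.1 (hc hy)).intervalIntegrable _ _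
  have h1 := hint (y := -π) (by simp [abs_of_pos pi_pos])
  have h2 := hint (y := π) (by simp [abs_of_pos pi_pos])
  simp only [Complex.ofReal_neg, neg_mul, ← sub_eq_add_neg] at h1
  rw [intervalIntegral.integral_sub h1 h2]
  have hrect := Complex.integral_boundary_rect_eq_zero_of_differentiable_on_off_countable
    (stieltjesQuotient ν θ b) (-R + (-π : ℝ) * I) (R + π * I) {(b : ℂ)} (Set.countable_singleton _)
    (hcont.mono fun ζ hζ => by
      have := hζ.2
      simp [Set.uIcc_of_le hpi] at this
      exact abs_le.2 this) (fun ζ hζ => by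
      have := hζ.1.2
      simp [hpi] at this
      exact stieltjesQuotient_differentiableAt hν h0 hθ (abs_le.2 ⟨this.1.le, this.2.le⟩) hζ.2)
  have hre : (-R + (-π : ℝ) * I : ℂ).re = -R := by simp
  have him : (-R + (-π : ℝ) * I : ℂ).im = -π := by simp
  have hre' : (R + π * I : ℂ).re = R := by simp
  have him' : (R + π * I : ℂ).im = π := by simp
  rw [hre, him, hre', him'] at hrect
  simp only [smul_eq_mul, Complex.ofReal_neg, neg_mul, ← sub_eq_add_neg] at hrect
  linear_combination hrect

lemma resolventSymbol_conj (θ : ℝ) (x : ℝ) :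
    resolventSymbol ν θ (x - π * I) = (starRingEnd ℂ) (resolventSymbol ν θ (x + π * I)) := by
  simp only [resolventSymbol, complexMGF, map_inv₀, map_add, Complex.conj_ofReal, ← integral_conj,
    ← Complex.exp_conj, map_mul, Complex.conj_I, id, mul_neg, ← sub_eq_add_neg]

lemma stieltjesQuotient_jump (θ b x : ℝ) :
    stieltjesQuotient ν θ b (x - π * I) - stieltjesQuotient ν θ b (x + π * I) =
      2 * I * (-(resolventSymbol ν θ (x + π * I)).im * (rexp x / (rexp x + rexp b)) : ℝ) := by
  have hne1 : (x - π * I : ℂ) ≠ b := fun h => by simpa using congrArg Complex.im h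
  have hne2 : (x + π * I : ℂ) ≠ b := fun h => by simpa using congrArg Complex.im h
  rw [stieltjesQuotient_of_ne θ hne1, stieltjesQuotient_of_ne θ hne2, resolventSymbol_conj,
    Complex.exp_sub, Complex.exp_add, Complex.exp_pi_mul_I]
  have hpos : (Complex.exp x + Complex.exp b : ℂ) ≠ 0 := by
    rw [← Complex.ofReal_exp, ← Complex.ofReal_exp, ← Complex.ofReal_add, Complex.ofReal_ne_zero]
    positivity
  have hneg : (-Complex.exp x - Complex.exp b : ℂ) ≠ 0 := by
    rw [← neg_ne_zero]; convert hpos using 1; ring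
  have hconj := Complex.sub_conj (resolventSymbol ν θ (x + π * I))
  push_cast at hconj ⊢
  simp only [div_neg, div_one, mul_neg, mul_one]
  have hd : Complex.exp x / (Complex.exp x + Complex.exp b) =
      -Complex.exp x / (-Complex.exp x - Complex.exp b) := by
    rw [div_eq_div_iff hpos hneg]; ring
  rw [hd]
  linear_combination (Complex.exp x / (-Complex.exp x - Complex.exp b)) * hconj

lemma tendsto_integral_of_norm_le {f : ℝ → ℝ → ℂ} {g : ℝ → ℝ} {c : ℂ}
    (hfc : ∀ᶠ R in atTop, ContinuousOn (f R) (Set.uIcc (-π) π))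
    (hfg : ∀ᶠ R in atTop, ∀ y, |y| ≤ π → ‖f R y - c‖ ≤ g R) (hg : Tendsto g atTop (𝓝 0)) :
    Tendsto (fun R => ∫ y in -π..π, f R y) atTop (𝓝 (2 * π * c)) := by
  rw [tendsto_iff_norm_sub_tendsto_zero]
  have hlim : Tendsto (fun R => g R * |π - -π|) atTop (𝓝 0) := by simpa using hg.mul_const _
  refine squeeze_zero' (.of_forall fun _ => norm_nonneg _) ?_ hlim
  filter_upwards [hfc, hfg] with R hc hb
  have hconst : (2 * π * c : ℂ) = ∫ _ in -π..π, c := by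
    rw [intervalIntegral.integral_const, Complex.real_smul]
    push_cast
    ring
  rw [hconst, ← intervalIntegral.integral_sub hc.intervalIntegrable
    intervalIntegrable_const]
  refine intervalIntegral.norm_integral_le_of_norm_le_const fun y hy => hb y ?_
  rw [Set.uIoc_of_le (by linarith [pi_pos])] at hy
  exact abs_le.2 ⟨hy.1.le, hy.2⟩

lemma tendsto_integral_stieltjesQuotient_right [IsFiniteMeasure ν]
    (hν : ∀ᵐ a ∂ν, a ∈ Set.Ioo (0:ℝ) 1) (h0 : ν ≠ 0) {θ : ℝ} (hθ : 0 ≤ θ) (b : ℝ) :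
    Tendsto (fun R : ℝ => ∫ y in -π..π, stieltjesQuotient ν θ b (R + y * I)) atTop
      (𝓝 (2 * π * -resolventSymbol ν θ b)) := by
  obtain ⟨c, hc, hS⟩ := exists_mul_le_sinSymbol hν h0
  have hexp : Tendsto (fun R : ℝ => rexp (b - R)) atTop (𝓝 0) :=
    tendsto_exp_atBot.comp (tendsto_atBot_add_const_left _ b tendsto_neg_atTop_atBot)
  have hinv : Tendsto (fun R : ℝ => (c * R)⁻¹) atTop (𝓝 0) :=
    tendsto_inv_atTop_zero.comp (tendsto_id.const_mul_atTop hc)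
  have hlim : Tendsto (fun R : ℝ => ((c * R)⁻¹ + ‖resolventSymbol ν θ b‖ * rexp (b - R)) /
      (1 - rexp (b - R))) atTop (𝓝 0) := by
    simpa [Pi.div_def] using (hinv.add (hexp.const_mul _)).div (hexp.const_sub 1) (by norm_num)
  refine tendsto_integral_of_norm_le (.of_forall fun R => ?_) ?_ hlim
  · refine (stieltjesQuotient_continuousOn hν h0 hθ b).comp (by fun_prop) fun y hy => ?_
    rw [Set.uIcc_of_le (by linarith [pi_pos])] at hy
    simpa using abs_le.2 hy
  · filter_upwards [eventually_gt_atTop 0, eventually_gt_atTop b] with R hR hbR y hy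
    have hne : (R + y * I : ℂ) ≠ b := fun h => hbR.ne' (by simpa using congrArg Complex.re h)
    have him : |(R + y * I : ℂ).im| ≤ π := by simpa using hy
    have hden := exp_ne_of_abs_im_le_pi hne him
    have hnum := norm_resolventSymbol_le hν h0 hθ him
    have hE : ‖Complex.exp (R + y * I)‖ = rexp R := by simp [Complex.norm_exp]
    have hEb : ‖Complex.exp b‖ = rexp b := by simp [Complex.norm_exp]
    have hσ : (sinSymbol ν R)⁻¹ ≤ (c * R)⁻¹ := inv_anti₀ (by positivity) (hS R).1
    have hre : (R + y * I : ℂ).re = R := by simp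
    rw [hre] at hnum
    have hlt : rexp (b - R) < 1 := by rw [exp_lt_one_iff]; linarith
    have hmul : rexp b = rexp R * rexp (b - R) := by rw [← Real.exp_add]; ring_nf
    have hform : stieltjesQuotient ν θ b (R + y * I) - -resolventSymbol ν θ b =
        (resolventSymbol ν θ (R + y * I) * Complex.exp (R + y * I) -
          resolventSymbol ν θ b * Complex.exp b) /
          (Complex.exp (R + y * I) - Complex.exp b) := by
      rw [stieltjesQuotient_of_ne θ hne]
      field_simp
      ring
    have hdlow : rexp R * (1 - rexp (b - R)) ≤ ‖Complex.exp (R + y * I) - Complex.exp b‖ := by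
      refine le_trans (le_of_eq ?_) (norm_sub_norm_le _ _)
      rw [hE, hEb, hmul]
      ring
    have hpos : 0 < 1 - rexp (b - R) := by linarith
    rw [hform, norm_div]
    refine (div_le_div_of_nonneg_left (norm_nonneg _) (by positivity) hdlow).trans ?_
    rw [div_le_div_iff₀ (by positivity) hpos]
    have hup : ‖resolventSymbol ν θ (R + y * I) * Complex.exp (R + y * I) -
        resolventSymbol ν θ b * Complex.exp b‖ ≤
        ((c * R)⁻¹ + ‖resolventSymbol ν θ b‖ * rexp (b - R)) * rexp R := by
      refine (norm_sub_le _ _).trans ?_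
      rw [norm_mul, norm_mul, hE, hEb, hmul]
      nlinarith [hnum.trans hσ, exp_pos R]
    nlinarith

lemma tendsto_integral_stieltjesQuotient_left [IsFiniteMeasure ν]
    (hν : ∀ᵐ a ∂ν, a ∈ Set.Ioo (0:ℝ) 1) (h0 : ν ≠ 0) {θ : ℝ} (hθ : 0 ≤ θ) (b : ℝ) :
    Tendsto (fun R : ℝ => ∫ y in -π..π, stieltjesQuotient ν θ b (-R + y * I)) atTop (𝓝 0) := by
  obtain ⟨c, hc, hS⟩ := exists_mul_le_sinSymbol hν h0
  have hexp : Tendsto (fun R : ℝ => rexp (-R)) atTop (𝓝 0) := tendsto_exp_neg_atTop_nhds_zero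
  have hinv : Tendsto (fun R : ℝ => (c * R)⁻¹) atTop (𝓝 0) :=
    tendsto_inv_atTop_zero.comp (tendsto_id.const_mul_atTop hc)
  have hlim : Tendsto (fun R : ℝ => ((c * R)⁻¹ + ‖resolventSymbol ν θ b‖ * rexp (-R)) /
      (rexp b - rexp (-R))) atTop (𝓝 0) := by
    simpa [Pi.div_def] using (hinv.add (hexp.const_mul _)).div (hexp.const_sub (rexp b))
      (by simp [(exp_pos b).ne'])
  have h := tendsto_integral_of_norm_le (f := fun R y => stieltjesQuotient ν θ b (-R + y * I))
    (c := 0) (.of_forall fun R => ?_) ?_ hlim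
  · simpa using h
  · refine (stieltjesQuotient_continuousOn hν h0 hθ b).comp (by fun_prop) fun y hy => ?_
    rw [Set.uIcc_of_le (by linarith [pi_pos])] at hy
    simpa using abs_le.2 hy
  · filter_upwards [eventually_gt_atTop 0, eventually_gt_atTop (-b)] with R hR hbR y hy
    have hne : (-R + y * I : ℂ) ≠ b := fun h => by
      have : -R = b := by simpa using congrArg Complex.re h
      linarith
    have him : |(-R + y * I : ℂ).im| ≤ π := by simpa using hy
    have hnum := norm_resolventSymbol_le hν h0 hθ him
    have hE : ‖Complex.exp (-R + y * I)‖ = rexp (-R) := by simp [Complex.norm_exp]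
    have hEb : ‖Complex.exp b‖ = rexp b := by simp [Complex.norm_exp]
    have hre : (-R + y * I : ℂ).re = -R := by simp
    rw [hre] at hnum
    have hσ : (sinSymbol ν (-R))⁻¹ * rexp (-R) ≤ (c * R)⁻¹ := by
      rw [Real.exp_neg, ← mul_inv]
      refine inv_anti₀ (by positivity) ?_
      rw [mul_comm (sinSymbol _ _)]
      exact (hS R).2
    have hlt : rexp (-R) < rexp b := exp_lt_exp.2 (by linarith)
    have hdlow : rexp b - rexp (-R) ≤ ‖Complex.exp (-R + y * I) - Complex.exp b‖ := by
      rw [norm_sub_rev]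
      refine le_trans (le_of_eq ?_) (norm_sub_norm_le _ _)
      rw [hE, hEb]
    rw [sub_zero, stieltjesQuotient_of_ne θ hne, div_mul_eq_mul_div, norm_div]
    have hpos : 0 < rexp b - rexp (-R) := sub_pos.2 hlt
    refine div_le_div₀ (by positivity) ?_ hpos hdlow
    rw [norm_mul, hE]
    calc _ ≤ (‖resolventSymbol ν θ (-R + y * I)‖ + ‖resolventSymbol ν θ b‖) * rexp (-R) := by
          gcongr; exact norm_sub_le _ _
      _ ≤ ((sinSymbol ν (-R))⁻¹ + ‖resolventSymbol ν θ b‖) * rexp (-R) := by gcongr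
      _ ≤ _ := by rw [add_mul]; gcongr

lemma resolventSymbol_ofReal (θ b : ℝ) :
    resolventSymbol ν θ b = ((θ + mgf id ν b)⁻¹ : ℝ) := by
  rw [resolventSymbol, complexMGF_ofReal]
  push_cast
  rfl

/-- The spectral density of the resolvent kernel, in the logarithmic variable. -/
noncomputable def spectralDensity (ν : Measure ℝ) (θ x : ℝ) : ℝ :=
  -(resolventSymbol ν θ (x + π * I)).im

lemma complexMGF_add_pi_mul_I [IsFiniteMeasure ν] (hν : ∀ᵐ a ∂ν, a ∈ Set.Ioo (0:ℝ) 1) (x : ℝ) :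
    complexMGF id ν (x + π * I) = (∫ a, rexp (x * a) * cos (π * a) ∂ν : ℝ) +
      (sinSymbol ν x : ℝ) * I := by
  have hexp : ∀ a : ℝ, Complex.exp ((x + π * I) * a) =
      ((rexp (x * a) * cos (π * a) : ℝ) : ℂ) + ((rexp (x * a) * sin (π * a) : ℝ) : ℂ) * I := by
    intro a
    have h : ((x + π * I) * a : ℂ) = (x * a : ℝ) + (π * a : ℝ) * I := by push_cast; ring
    rw [h, Complex.exp_add, Complex.exp_mul_I]
    push_cast
    ring
  simp only [complexMGF, id, hexp]
  rw [integral_add, integral_mul_const, integral_complex_ofReal, integral_complex_ofReal, sinSymbol]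
  · exact (integrable_exp_mul_mul_of_bounded hν x (by fun_prop) fun a _ => abs_cos_le_one _).ofReal
  · exact (integrable_exp_mul_mul_of_bounded hν x (by fun_prop)
      fun a _ => abs_sin_le_one _).ofReal.mul_const _

lemma spectralDensity_eq [IsFiniteMeasure ν] (hν : ∀ᵐ a ∂ν, a ∈ Set.Ioo (0:ℝ) 1) (θ x : ℝ) :
    spectralDensity ν θ x = sinSymbol ν x /
      (sinSymbol ν x ^ 2 + (θ + ∫ a, rexp (x * a) * cos (π * a) ∂ν) ^ 2) := by
  rw [spectralDensity, resolventSymbol, complexMGF_add_pi_mul_I hν, Complex.inv_im,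
    Complex.normSq_apply]
  simp
  ring

lemma spectralDensity_nonneg [IsFiniteMeasure ν] (hν : ∀ᵐ a ∂ν, a ∈ Set.Ioo (0:ℝ) 1)
    (h0 : ν ≠ 0) (θ x : ℝ) : 0 ≤ spectralDensity ν θ x := by
  rw [spectralDensity_eq hν]
  have := sinSymbol_pos hν h0 x
  positivity

lemma continuous_spectralDensity [IsFiniteMeasure ν] (hν : ∀ᵐ a ∂ν, a ∈ Set.Ioo (0:ℝ) 1)
    (h0 : ν ≠ 0) {θ : ℝ} (hθ : 0 ≤ θ) : Continuous (spectralDensity ν θ) := by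
  rw [continuous_iff_continuousAt]
  intro x
  have h : ContinuousAt (resolventSymbol ν θ) (x + π * I) :=
    (resolventSymbol_differentiableAt hν h0 hθ (by simp [abs_of_pos pi_pos])).continuousAt
  exact (Complex.continuous_im.continuousAt.comp
    (h.comp (f := fun x : ℝ => (x + π * I : ℂ)) (by fun_prop))).neg

/-- The Stieltjes representation of the real resolvent symbol. -/
theorem integral_spectralDensity_stieltjes [IsFiniteMeasure ν]
    (hν : ∀ᵐ a ∂ν, a ∈ Set.Ioo (0:ℝ) 1) (h0 : ν ≠ 0) {θ : ℝ} (hθ : 0 ≤ θ) (b : ℝ) :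
    Integrable (fun x => spectralDensity ν θ x * (rexp x / (rexp x + rexp b))) ∧
    ∫ x, spectralDensity ν θ x * (rexp x / (rexp x + rexp b)) = π * (θ + mgf id ν b)⁻¹ := by
  set h : ℝ → ℝ := fun x => spectralDensity ν θ x * (rexp x / (rexp x + rexp b)) with hh
  have hcont : Continuous h := (continuous_spectralDensity hν h0 hθ).mul
    (by fun_prop (disch := intros; positivity))
  have hnn : ∀ x, 0 ≤ h x := fun x => mul_nonneg (spectralDensity_nonneg hν h0 θ x) (by positivity)
  have hlim : Tendsto (fun R : ℝ => ∫ x in -R..R, h x) atTop (𝓝 (π * (θ + mgf id ν b)⁻¹)) := by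
    have hb := ((tendsto_integral_stieltjesQuotient_left hν h0 hθ b).const_mul I).sub
      ((tendsto_integral_stieltjesQuotient_right hν h0 hθ b).const_mul I)
    simp only [← integral_boundary_stieltjesQuotient hν h0 hθ, stieltjesQuotient_jump,
      intervalIntegral.integral_const_mul, intervalIntegral.integral_ofReal] at hb
    have hb' := (Complex.continuous_re.tendsto _).comp (hb.const_mul (2 * I)⁻¹)
    have h2I : (2 * I : ℂ) ≠ 0 := by simp
    convert hb' using 1
    · ext R
      simp only [Function.comp_apply, inv_mul_cancel_left₀ h2I, Complex.ofReal_re]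
      rfl
    · rw [resolventSymbol_ofReal]
      congr 1
      have he : (2 * I)⁻¹ * (I * 0 - I * (2 * π * -((θ + mgf id ν b)⁻¹ : ℝ))) =
          ((π * (θ + mgf id ν b)⁻¹ : ℝ) : ℂ) := by
        field_simp
        push_cast
        ring
      rw [he, Complex.ofReal_re]
  have hint : Integrable h := by
    refine integrable_of_intervalIntegral_norm_tendsto (l := atTop) (a := fun R : ℝ => -R)
      (b := fun R => R) (π * (θ + mgf id ν b)⁻¹) (fun R => ?_) tendsto_neg_atTop_atBot
      tendsto_id ?_
    · exact hcont.integrableOn_Ioc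
    · simpa only [Real.norm_eq_abs, abs_of_nonneg (hnn _)] using hlim
  exact ⟨hint, tendsto_nhds_unique (intervalIntegral_tendsto_integral hint
    tendsto_neg_atTop_atBot tendsto_id) hlim⟩

end Stieltjes

section LaplaceUniqueness

/-- Finite measures on the line whose exponential moments agree and are finite on a half-line
`(-∞, c)` with `0 < c` are equal. -/
theorem ext_of_lintegral_exp_eq {m₁ m₂ : Measure ℝ} [IsFiniteMeasure m₁] [IsFiniteMeasure m₂]
    {c : ℝ} (hc : 0 < c)
    (hfin : ∀ σ < c, ∫⁻ x, ENNReal.ofReal (rexp (σ * x)) ∂m₁ ≠ ⊤)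
    (heq : ∀ σ < c, ∫⁻ x, ENNReal.ofReal (rexp (σ * x)) ∂m₁ =
      ∫⁻ x, ENNReal.ofReal (rexp (σ * x)) ∂m₂) : m₁ = m₂ := by
  have hi : ∀ {m : Measure ℝ}, (∀ σ < c, ∫⁻ x, ENNReal.ofReal (rexp (σ * x)) ∂m ≠ ⊤) →
      ∀ σ < c, Integrable (fun x => rexp (σ * x)) m := fun h σ hσ => by
    refine ⟨by fun_prop, ?_⟩
    rw [hasFiniteIntegral_iff_ofReal (.of_forall fun x => (exp_pos _).le)]
    exact (h σ hσ).lt_top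
  have h1 := hi hfin
  have h2 := hi (fun σ hσ => heq σ hσ ▸ hfin σ hσ)
  have hmgf : ∀ σ < c, mgf id m₁ σ = mgf id m₂ σ := fun σ hσ => by
    simp only [mgf, id]
    rw [integral_eq_lintegral_of_nonneg_ae (.of_forall fun x => (exp_pos _).le) (by fun_prop),
      integral_eq_lintegral_of_nonneg_ae (.of_forall fun x => (exp_pos _).le) (by fun_prop),
      heq σ hσ]
  have han : ∀ {m : Measure ℝ}, (∀ σ < c, Integrable (fun x => rexp (σ * x)) m) →
      AnalyticOnNhd ℂ (complexMGF id m) {z | z.re < c} := fun {m} h z hz => by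
    refine analyticAt_complexMGF ?_
    exact interior_maximal (fun σ (hσ : σ < c) => h σ hσ) isOpen_Iio hz
  have hpre : IsPreconnected {z : ℂ | z.re < c} :=
    (convex_halfSpace_re_lt c).isPreconnected
  have hon : Set.EqOn (complexMGF id m₁) (complexMGF id m₂) {z | z.re < c} := by
    refine (han h1).eqOn_of_preconnected_of_frequently_eq (han h2) hpre (z₀ := 0) (by simpa) ?_
    have hreal : ∃ᶠ x : ℝ in 𝓝[≠] 0, complexMGF id m₁ x = complexMGF id m₂ x := by
      refine Eventually.frequently ?_
      filter_upwards [nhdsWithin_le_nhds (Iio_mem_nhds hc)] with x hx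
      rw [complexMGF_ofReal, complexMGF_ofReal, hmgf x hx]
    have ht : Tendsto (fun x : ℝ => (x : ℂ)) (𝓝[≠] 0) (𝓝[≠] 0) := by
      refine tendsto_nhdsWithin_iff.2 ⟨?_, ?_⟩
      · simpa using (Complex.continuous_ofReal.tendsto 0).mono_left nhdsWithin_le_nhds
      · filter_upwards [self_mem_nhdsWithin] with x hx
        simpa using hx
    exact ht.frequently hreal
  refine Measure.ext_of_charFun (funext fun t => ?_)
  rw [← complexMGF_id_mul_I, ← complexMGF_id_mul_I]
  exact hon (by simpa using hc)

/-- Uniqueness of the Laplace transform for nonnegative continuous functions on `(0,∞)`. -/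
theorem eqOn_of_laplace_eq {f g : ℝ → ℝ} (hf : ContinuousOn f (Set.Ioi 0))
    (hg : ContinuousOn g (Set.Ioi 0)) (hf0 : ∀ t > 0, 0 ≤ f t) (hg0 : ∀ t > 0, 0 ≤ g t)
    (hfin : ∀ s > 0, ∫⁻ t in Set.Ioi (0:ℝ), ENNReal.ofReal (rexp (-(s * t)) * f t) ≠ ⊤)
    (heq : ∀ s > 0, ∫⁻ t in Set.Ioi (0:ℝ), ENNReal.ofReal (rexp (-(s * t)) * f t) =
      ∫⁻ t in Set.Ioi (0:ℝ), ENNReal.ofReal (rexp (-(s * t)) * g t)) :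
    Set.EqOn f g (Set.Ioi 0) := by
  have hmeas : ∀ {h : ℝ → ℝ}, ContinuousOn h (Set.Ioi 0) →
      AEMeasurable (fun t => ENNReal.ofReal (rexp (-(1 * t)) * h t))
        (volume.restrict (Set.Ioi 0)) := fun {h} hh => by
    have hc : ContinuousOn (fun t => rexp (-(1 * t)) * h t) (Set.Ioi 0) := by fun_prop
    exact (hc.aemeasurable measurableSet_Ioi).ennreal_ofReal
  have hexp : ∀ {h : ℝ → ℝ}, ContinuousOn h (Set.Ioi 0) → ∀ σ : ℝ,
      ∫⁻ x, ENNReal.ofReal (rexp (σ * x)) ∂(volume.restrict (Set.Ioi (0:ℝ))).withDensity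
        (fun t => ENNReal.ofReal (rexp (-(1 * t)) * h t)) =
      ∫⁻ t in Set.Ioi (0:ℝ), ENNReal.ofReal (rexp (-((1 - σ) * t)) * h t) := fun {h} hh σ => by
    rw [lintegral_withDensity_eq_lintegral_mul₀ (hmeas hh) (by fun_prop)]
    refine lintegral_congr fun t => ?_
    rw [Pi.mul_apply, mul_comm, ← ENNReal.ofReal_mul (exp_pos _).le, ← mul_assoc, ← Real.exp_add]
    ring_nf
  have hf1 : IsFiniteMeasure ((volume.restrict (Set.Ioi (0:ℝ))).withDensity
      (fun t => ENNReal.ofReal (rexp (-(1 * t)) * f t))) :=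
    isFiniteMeasure_withDensity (hfin 1 one_pos)
  have hg1 : IsFiniteMeasure ((volume.restrict (Set.Ioi (0:ℝ))).withDensity
      (fun t => ENNReal.ofReal (rexp (-(1 * t)) * g t))) :=
    isFiniteMeasure_withDensity (heq 1 one_pos ▸ hfin 1 one_pos)
  have hm := ext_of_lintegral_exp_eq (m₁ := (volume.restrict (Set.Ioi (0:ℝ))).withDensity
      (fun t => ENNReal.ofReal (rexp (-(1 * t)) * f t)))
    (m₂ := (volume.restrict (Set.Ioi (0:ℝ))).withDensity
      (fun t => ENNReal.ofReal (rexp (-(1 * t)) * g t))) one_pos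
    (fun σ hσ => by rw [hexp hf]; exact hfin _ (sub_pos.2 hσ))
    (fun σ hσ => by rw [hexp hf, hexp hg]; exact heq _ (sub_pos.2 hσ))
  rw [withDensity_eq_iff (hmeas hf) (hmeas hg) (hfin 1 one_pos)] at hm
  refine Measure.eqOn_open_of_ae_eq (μ := volume) ?_ isOpen_Ioi hf hg
  filter_upwards [hm, ae_restrict_mem measurableSet_Ioi] with t ht ht0
  rw [ENNReal.ofReal_eq_ofReal_iff (mul_nonneg (exp_pos _).le (hf0 t ht0))
    (mul_nonneg (exp_pos _).le (hg0 t ht0))] at ht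
  exact mul_left_cancel₀ (exp_pos _).ne' ht

end LaplaceUniqueness

section Convolution

lemma intervalIntegrable_convolution {u l : ℝ → ℝ} (hu : ContinuousOn u (Set.Ioi 0))
    (hl : ContinuousOn l (Set.Ioi 0)) (hu0 : ∀ t > 0, 0 ≤ u t) (hl0 : ∀ t > 0, 0 ≤ l t)
    (hua : AntitoneOn u (Set.Ioi 0)) (hla : AntitoneOn l (Set.Ioi 0)) {t : ℝ} (ht : 0 < t)
    (hui : IntervalIntegrable u volume 0 t) (hli : IntervalIntegrable l volume 0 t) :
    IntervalIntegrable (fun τ => u (t - τ) * l τ) volume 0 t := by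
  have hui' : IntervalIntegrable (fun τ => u (t - τ)) volume 0 t := by
    simpa using (hui.comp_sub_left t).symm
  have hb := (hli.const_mul (u (t / 2))).add (hui'.mul_const (l (t / 2)))
  rw [intervalIntegrable_iff_integrableOn_Ioo_of_le ht.le] at hb ⊢
  refine hb.mono' (ContinuousOn.aestronglyMeasurable ?_ measurableSet_Ioo) ?_
  · exact (hu.comp (by fun_prop) fun τ hτ => sub_pos.2 hτ.2).mul (hl.mono fun τ hτ => hτ.1)
  · filter_upwards [ae_restrict_mem measurableSet_Ioo] with τ hτ
    have h1 : 0 < t - τ := sub_pos.2 hτ.2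
    have h2 : 0 < t / 2 := half_pos ht
    have := hu0 _ h1
    have := hl0 _ hτ.1
    have := hu0 _ h2
    have := hl0 _ h2
    rw [Real.norm_of_nonneg (by positivity)]
    rcases le_total τ (t / 2) with h | h
    · have : u (t - τ) ≤ u (t / 2) := hua h2 h1 (by linarith)
      nlinarith [mul_nonneg (hu0 _ h1) (hl0 _ h2), mul_le_mul_of_nonneg_right this (hl0 _ hτ.1)]
    · have : l τ ≤ l (t / 2) := hla h2 hτ.1 h
      nlinarith [mul_nonneg (hu0 _ h2) (hl0 _ hτ.1), mul_le_mul_of_nonneg_left this (hu0 _ h1)]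

lemma continuousOn_convolution {u l : ℝ → ℝ} (hu : ContinuousOn u (Set.Ioi 0))
    (hl : ContinuousOn l (Set.Ioi 0)) (hu0 : ∀ t > 0, 0 ≤ u t) (hl0 : ∀ t > 0, 0 ≤ l t)
    (hua : AntitoneOn u (Set.Ioi 0)) (hla : AntitoneOn l (Set.Ioi 0))
    (hui : ∀ t > 0, IntervalIntegrable u volume 0 t)
    (hli : ∀ t > 0, IntervalIntegrable l volume 0 t) :
    ContinuousOn (fun t => ∫ τ in (0:ℝ)..t, u (t - τ) * l τ) (Set.Ioi 0) := by
  have hscale : ∀ t ∈ Set.Ioi (0:ℝ), ∫ τ in (0:ℝ)..t, u (t - τ) * l τ =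
      t * ∫ v in (0:ℝ)..1, u (t - t * v) * l (t * v) := fun t ht => by
    have h := intervalIntegral.integral_comp_mul_left (a := 0) (b := 1)
      (fun τ => u (t - τ) * l τ) (ne_of_gt ht)
    rw [h, mul_zero, mul_one, smul_eq_mul, mul_inv_cancel_left₀ (ne_of_gt ht)]
  refine ContinuousOn.congr (ContinuousOn.mul continuousOn_id fun t₁ (ht₁ : 0 < t₁) => ?_) hscale
  have ht₀ : 0 < t₁ / 2 := half_pos ht₁
  have hne : ∀ᵐ v : ℝ, v ≠ 1 := by simp [ae_iff]
  have hint := (intervalIntegrable_convolution hu hl hu0 hl0 hua hla ht₀ (hui _ ht₀)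
    (hli _ ht₀)).comp_mul_left (c := t₁ / 2)
  rw [zero_div, div_self ht₀.ne'] at hint
  have hmem : ∀ {t v : ℝ}, 0 < t → v ∈ Set.Ioo (0:ℝ) 1 → 0 < t - t * v ∧ 0 < t * v :=
    fun ht hv => ⟨by nlinarith [hv.2], mul_pos ht hv.1⟩
  have hioo : ∀ {v : ℝ}, v ≠ 1 → v ∈ Set.uIoc (0:ℝ) 1 → v ∈ Set.Ioo (0:ℝ) 1 := fun h hv => by
    rw [Set.uIoc_of_le zero_le_one] at hv
    exact ⟨hv.1, lt_of_le_of_ne hv.2 h⟩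
  refine (intervalIntegral.continuousAt_of_dominated_interval ?_ ?_ hint ?_).continuousWithinAt
  · filter_upwards [lt_mem_nhds ht₁] with t ht
    rw [Set.uIoc_of_le zero_le_one, ← restrict_Ioo_eq_restrict_Ioc]
    refine ContinuousOn.aestronglyMeasurable ?_ measurableSet_Ioo
    exact (hu.comp (by fun_prop) fun v hv => (hmem ht hv).1).mul
      (hl.comp (by fun_prop) fun v hv => (hmem ht hv).2)
  · filter_upwards [lt_mem_nhds (half_lt_self ht₁)] with t ht
    filter_upwards [hne] with v hv hv'
    have hv := hioo hv hv'
    have h := hmem ht₀ hv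
    have h' := hmem (ht₀.trans ht) hv
    rw [Real.norm_of_nonneg (mul_nonneg (hu0 _ h'.1) (hl0 _ h'.2))]
    refine mul_le_mul (hua h.1 h'.1 ?_) (hla h.2 h'.2 ?_) (hl0 _ h'.2) (hu0 _ h.1)
    · nlinarith [hv.2]
    · nlinarith [hv.1]
  · filter_upwards [hne] with v hv hv'
    have h := hmem ht₁ (hioo hv hv')
    have hcu : ContinuousAt u (t₁ - t₁ * v) := hu.continuousAt (Ioi_mem_nhds h.1)
    have hcl : ContinuousAt l (t₁ * v) := hl.continuousAt (Ioi_mem_nhds h.2)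
    exact (hcu.comp (f := fun t => t - t * v) (by fun_prop)).mul
      (hcl.comp (f := fun t => t * v) (by fun_prop))

/-- The Laplace transform turns the half-line convolution into a product. -/
theorem lintegral_laplace_convolution {u l : ℝ → ℝ} (hu : ContinuousOn u (Set.Ioi 0))
    (hl : ContinuousOn l (Set.Ioi 0)) (hu0 : ∀ t > 0, 0 ≤ u t) (hl0 : ∀ t > 0, 0 ≤ l t)
    (hint : ∀ t > 0, IntervalIntegrable (fun τ => u (t - τ) * l τ) volume 0 t) (s : ℝ) :
    ∫⁻ t in Set.Ioi (0:ℝ), ENNReal.ofReal (rexp (-(s * t)) * ∫ τ in (0:ℝ)..t, u (t - τ) * l τ) =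
      (∫⁻ t in Set.Ioi (0:ℝ), ENNReal.ofReal (rexp (-(s * t)) * u t)) *
        ∫⁻ t in Set.Ioi (0:ℝ), ENNReal.ofReal (rexp (-(s * t)) * l t) := by
  set E : (ℝ → ℝ) → ℝ → ENNReal := fun f =>
    (Set.Ioi (0:ℝ)).indicator fun t => ENNReal.ofReal (rexp (-(s * t)) * f t) with hE
  have hEm : ∀ {f : ℝ → ℝ}, ContinuousOn f (Set.Ioi 0) → Measurable (E f) := fun {f} hf => by
    have hc : ContinuousOn (fun t => ENNReal.ofReal (rexp (-(s * t)) * f t)) (Set.Ioi 0) :=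
      ENNReal.continuous_ofReal.comp_continuousOn (by fun_prop)
    have := hc.measurable_piecewise (g := 0) continuousOn_const measurableSet_Ioi
    rwa [Set.piecewise_eq_indicator] at this
  have hinner : ∀ t, (Set.Ioi (0:ℝ)).indicator (fun t =>
      ENNReal.ofReal (rexp (-(s * t)) * ∫ τ in (0:ℝ)..t, u (t - τ) * l τ)) t =
      ∫⁻ τ, E u (t - τ) * E l τ := fun t => by
    have hprod : ∀ τ, E u (t - τ) * E l τ = (Set.Ioo 0 t).indicator
        (fun τ => ENNReal.ofReal (rexp (-(s * t)) * (u (t - τ) * l τ))) τ := fun τ => by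
      by_cases hτ : τ ∈ Set.Ioo 0 t
      · have h1 : t - τ ∈ Set.Ioi (0:ℝ) := sub_pos.2 hτ.2
        have h2 : τ ∈ Set.Ioi (0:ℝ) := hτ.1
        simp only [hE, Set.indicator_of_mem h1, Set.indicator_of_mem h2, Set.indicator_of_mem hτ]
        rw [← ENNReal.ofReal_mul (mul_nonneg (exp_pos _).le (hu0 _ h1))]
        have he : rexp (-(s * t)) = rexp (-(s * (t - τ))) * rexp (-(s * τ)) := by
          rw [← Real.exp_add]; ring_nf
        rw [he]
        ring_nf
      · rw [Set.indicator_of_notMem hτ]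
        rcases not_and_or.1 hτ with h | h
        · simp [hE, Set.indicator_of_notMem (s := Set.Ioi (0:ℝ)) h]
        · have : t - τ ∉ Set.Ioi (0:ℝ) := fun h' => h (sub_pos.1 h')
          simp [hE, Set.indicator_of_notMem this]
    simp only [hprod]
    rw [lintegral_indicator measurableSet_Ioo]
    by_cases ht : t ∈ Set.Ioi (0:ℝ)
    · rw [Set.indicator_of_mem ht, ← intervalIntegral.integral_const_mul,
        intervalIntegral.integral_of_le (le_of_lt ht), ← restrict_Ioo_eq_restrict_Ioc]
      refine ofReal_integral_eq_lintegral_ofReal ?_ ?_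
      · exact ((intervalIntegrable_iff_integrableOn_Ioo_of_le (le_of_lt ht)).1
          ((hint t ht).const_mul _))
      · filter_upwards [ae_restrict_mem measurableSet_Ioo] with τ hτ
        exact mul_nonneg (exp_pos _).le
          (mul_nonneg (hu0 _ (sub_pos.2 hτ.2)) (hl0 _ hτ.1))
    · rw [Set.indicator_of_notMem ht, Set.Ioo_eq_empty ht]
      simp
  rw [← lintegral_indicator measurableSet_Ioi, lintegral_congr hinner, lintegral_lintegral_swap]
  · have hshift : ∀ τ, ∫⁻ t, E u (t - τ) * E l τ = (∫⁻ t, E u t) * E l τ := fun τ => by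
      have hm : Measurable fun t => E u (t - τ) := (hEm hu).comp (measurable_id.sub_const _)
      rw [lintegral_mul_const _ hm, lintegral_sub_right_eq_self (E u) τ]
    simp_rw [hshift]
    rw [lintegral_const_mul _ (hEm hl), hE, lintegral_indicator measurableSet_Ioi,
      lintegral_indicator measurableSet_Ioi]
  · exact (((hEm hu).comp (measurable_fst.sub measurable_snd)).mul
      ((hEm hl).comp measurable_snd)).aemeasurable

end Convolution

section LaplaceKernel

/-- The completely monotone kernel `t ↦ (1/π) ∫₀^∞ e^{-pt} H(p) dp`. -/
noncomputable def laplaceKernel (H : ℝ → ℝ) (t : ℝ) : ℝ :=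
  (1 / π) * ∫ p in Set.Ioi (0:ℝ), rexp (-(p * t)) * H p

variable {H : ℝ → ℝ}

lemma integrableOn_exp_mul_of_stieltjes (hm : ContinuousOn H (Set.Ioi 0))
    (hi : IntegrableOn (fun p => H p / (p + 1)) (Set.Ioi 0)) {t : ℝ} (ht : 0 < t) :
    IntegrableOn (fun p => rexp (-(p * t)) * H p) (Set.Ioi 0) := by
  refine (hi.norm.const_mul (1 + 1 / t)).mono' ?_ ?_
  · exact ContinuousOn.aestronglyMeasurable (by fun_prop) measurableSet_Ioi
  · filter_upwards [ae_restrict_mem measurableSet_Ioi] with p (hp : 0 < p)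
    rw [norm_mul, norm_div, Real.norm_of_nonneg (exp_pos _).le,
      Real.norm_of_nonneg (by positivity : 0 ≤ p + 1), mul_div_assoc', mul_comm _ ‖H p‖,
      mul_comm _ ‖H p‖, mul_div_assoc]
    refine mul_le_mul_of_nonneg_left ?_ (norm_nonneg _)
    rw [le_div_iff₀ (by positivity), Real.exp_neg, inv_mul_le_iff₀ (exp_pos _)]
    have h1 := add_one_le_exp (p * t)
    have h2 : p + 1 ≤ (p * t + 1) * (1 + 1 / t) := by
      field_simp
      nlinarith [mul_pos hp ht, mul_pos (mul_pos hp ht) ht]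
    exact h2.trans (by gcongr)

lemma laplaceKernel_nonneg (h0 : ∀ p > 0, 0 ≤ H p) (t : ℝ) : 0 ≤ laplaceKernel H t :=
  mul_nonneg (by positivity) (setIntegral_nonneg measurableSet_Ioi fun p hp =>
    mul_nonneg (exp_pos _).le (h0 p hp))

lemma antitoneOn_laplaceKernel (hm : ContinuousOn H (Set.Ioi 0)) (h0 : ∀ p > 0, 0 ≤ H p)
    (hi : IntegrableOn (fun p => H p / (p + 1)) (Set.Ioi 0)) :
    AntitoneOn (laplaceKernel H) (Set.Ioi 0) := fun t ht t' ht' htt' => by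
  refine mul_le_mul_of_nonneg_left ?_ (by positivity)
  refine setIntegral_mono_on (integrableOn_exp_mul_of_stieltjes hm hi ht')
    (integrableOn_exp_mul_of_stieltjes hm hi ht) measurableSet_Ioi fun p (hp : 0 < p) => ?_
  have := h0 p hp
  gcongr

lemma continuousOn_laplaceKernel (hm : ContinuousOn H (Set.Ioi 0)) (h0 : ∀ p > 0, 0 ≤ H p)
    (hi : IntegrableOn (fun p => H p / (p + 1)) (Set.Ioi 0)) :
    ContinuousOn (laplaceKernel H) (Set.Ioi 0) := fun t₁ (ht₁ : 0 < t₁) => by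
  refine ContinuousAt.continuousWithinAt (ContinuousAt.mul continuousAt_const ?_)
  refine continuousAt_of_dominated ?_ ?_ (integrableOn_exp_mul_of_stieltjes hm hi (half_pos ht₁)) ?_
  · exact .of_forall fun t => ContinuousOn.aestronglyMeasurable (by fun_prop) measurableSet_Ioi
  · filter_upwards [lt_mem_nhds (half_lt_self ht₁)] with t ht
    filter_upwards [ae_restrict_mem measurableSet_Ioi] with p (hp : 0 < p)
    have := h0 p hp
    rw [Real.norm_of_nonneg (by positivity)]
    gcongr
  · exact .of_forall fun p => by fun_prop

lemma lintegral_laplace_laplaceKernel (hm : ContinuousOn H (Set.Ioi 0)) (h0 : ∀ p > 0, 0 ≤ H p)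
    (hi : IntegrableOn (fun p => H p / (p + 1)) (Set.Ioi 0)) {s : ℝ} (hs : 0 < s) :
    ∫⁻ t in Set.Ioi (0:ℝ), ENNReal.ofReal (rexp (-(s * t)) * laplaceKernel H t) =
      ∫⁻ p in Set.Ioi (0:ℝ), ENNReal.ofReal (1 / π * (H p / (p + s))) := by
  have hpi : (0:ℝ) ≤ 1 / π := by positivity
  have hmH : AEMeasurable (fun p => ENNReal.ofReal (1 / π * H p))
      (volume.restrict (Set.Ioi 0)) :=
    ((hm.aemeasurable measurableSet_Ioi).const_mul _).ennreal_ofReal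
  have hinner : ∀ t ∈ Set.Ioi (0:ℝ), ENNReal.ofReal (rexp (-(s * t)) * laplaceKernel H t) =
      ∫⁻ p in Set.Ioi (0:ℝ), ENNReal.ofReal (1 / π * H p) *
        ENNReal.ofReal (rexp (-(p + s) * t)) := fun t ht => by
    have hint := ((integrableOn_exp_mul_of_stieltjes hm hi ht).const_mul (1 / π)).const_mul
      (rexp (-(s * t)))
    rw [laplaceKernel, ← integral_const_mul, ← integral_const_mul,
      ofReal_integral_eq_lintegral_ofReal hint]
    · refine setLIntegral_congr_fun measurableSet_Ioi fun p (hp : 0 < p) => ?_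
      rw [← ENNReal.ofReal_mul (mul_nonneg hpi (h0 p hp))]
      have he : rexp (-(p + s) * t) = rexp (-(s * t)) * rexp (-(p * t)) := by
        rw [← Real.exp_add]; ring_nf
      rw [he]
      ring_nf
    · filter_upwards [ae_restrict_mem measurableSet_Ioi] with p (hp : 0 < p)
      have := h0 p hp
      simp only [Pi.zero_apply]
      positivity
  rw [setLIntegral_congr_fun measurableSet_Ioi hinner, lintegral_lintegral_swap]
  · refine setLIntegral_congr_fun measurableSet_Ioi fun p (hp : 0 < p) => ?_
    have hneg : -(p + s) < 0 := by linarith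
    rw [lintegral_const_mul _ (by fun_prop), ← ofReal_integral_eq_lintegral_ofReal
      (integrableOn_exp_mul_Ioi hneg 0) (.of_forall fun t => (exp_pos _).le),
      integral_exp_mul_Ioi hneg, ← ENNReal.ofReal_mul (mul_nonneg hpi (h0 p hp))]
    congr 1
    rw [mul_zero, Real.exp_zero, neg_div_neg_eq]
    ring
  · have hk : Measurable fun z : ℝ × ℝ => ENNReal.ofReal (rexp (-(z.2 + s) * z.1)) := by fun_prop
    exact hmH.comp_snd.mul hk.aemeasurable

lemma intervalIntegrable_of_lintegral_laplace_ne_top {f : ℝ → ℝ}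
    (hf : ContinuousOn f (Set.Ioi 0)) (h0 : ∀ t > 0, 0 ≤ f t)
    (hfin : ∫⁻ t in Set.Ioi (0:ℝ), ENNReal.ofReal (rexp (-(1 * t)) * f t) ≠ ⊤) {t : ℝ}
    (ht : 0 < t) : IntervalIntegrable f volume 0 t := by
  have hint : IntegrableOn (fun t => rexp (-(1 * t)) * f t) (Set.Ioi 0) := by
    refine ⟨ContinuousOn.aestronglyMeasurable (by fun_prop) measurableSet_Ioi, ?_⟩
    rw [hasFiniteIntegral_iff_ofReal]
    · exact hfin.lt_top
    · filter_upwards [ae_restrict_mem measurableSet_Ioi] with p hp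
      exact mul_nonneg (exp_pos _).le (h0 p hp)
  have hint' : IntervalIntegrable (fun t => rexp (-(1 * t)) * f t) volume 0 t :=
    (intervalIntegrable_iff_integrableOn_Ioc_of_le ht.le).2
      (hint.mono_set Set.Ioc_subset_Ioi_self)
  refine (hint'.continuousOn_mul (g := rexp) (by fun_prop)).congr fun x _ => ?_
  simp only [← mul_assoc, ← Real.exp_add, one_mul, add_neg_cancel, Real.exp_zero]

end LaplaceKernel

section Resolvent

variable {μ : Measure ℝ}

lemma IsDistOrderMeasure.ae_mem_Ioo (hμ : IsDistOrderMeasure μ) :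
    ∀ᵐ a ∂μ, a ∈ Set.Ioo (0:ℝ) 1 := by
  obtain ⟨-, M, α, q, w, -, hα, -, -, -, rfl⟩ := hμ
  rw [ae_add_measure_iff]
  constructor
  · rw [← Measure.sum_fintype, Measure.ae_sum_iff]
    exact fun n => Measure.ae_smul_measure ((ae_dirac_iff measurableSet_Ioo).2 (hα n)) _
  · exact (withDensity_absolutelyContinuous _ _).ae_le (ae_restrict_mem measurableSet_Ioo)

lemma IsDistOrderMeasure.restrict_Ioc (hμ : IsDistOrderMeasure μ) :
    μ.restrict (Set.Ioc 0 1) = μ :=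
  Measure.restrict_eq_self_of_ae_mem
    (hμ.ae_mem_Ioo.mono fun _ ha => Set.Ioo_subset_Ioc_self ha)

lemma rtheta_eq_laplaceKernel [IsFiniteMeasure μ] (hμ : IsDistOrderMeasure μ) (θ : ℝ) :
    rtheta μ θ = laplaceKernel fun p => spectralDensity μ θ (log p) := by
  ext t
  rw [rtheta, laplaceKernel, hμ.restrict_Ioc]
  congr 1
  refine setIntegral_congr_fun measurableSet_Ioi fun p hp => ?_
  simp only [spectralDensity_eq hμ.ae_mem_Ioo, sinSymbol, rpow_def_of_pos hp]

lemma lker_eq_rtheta_zero : lker μ = rtheta μ 0 := by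
  ext t
  simp only [lker, rtheta, Hker, zero_add]

variable {ν : Measure ℝ}

lemma continuousOn_spectralDensity_log [IsFiniteMeasure ν]
    (hν : ∀ᵐ a ∂ν, a ∈ Set.Ioo (0:ℝ) 1) (h0 : ν ≠ 0) {θ : ℝ} (hθ : 0 ≤ θ) :
    ContinuousOn (fun p => spectralDensity ν θ (log p)) (Set.Ioi 0) :=
  (continuous_spectralDensity hν h0 hθ).comp_continuousOn
    (continuousOn_log.mono fun _ hp => ne_of_gt hp)

lemma integral_spectralDensity_log_stieltjes [IsFiniteMeasure ν]
    (hν : ∀ᵐ a ∂ν, a ∈ Set.Ioo (0:ℝ) 1) (h0 : ν ≠ 0) {θ : ℝ} (hθ : 0 ≤ θ) {s : ℝ} (hs : 0 < s) :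
    IntegrableOn (fun p => spectralDensity ν θ (log p) / (p + s)) (Set.Ioi 0) ∧
    ∫ p in Set.Ioi (0:ℝ), spectralDensity ν θ (log p) / (p + s) =
      π * (θ + mgf id ν (log s))⁻¹ := by
  have h := integral_spectralDensity_stieltjes hν h0 hθ (log s)
  have hfun : (fun x => spectralDensity ν θ x * (rexp x / (rexp x + rexp (log s)))) =
      fun x => |rexp x| • (spectralDensity ν θ (log (rexp x)) / (rexp x + s)) := by
    ext x
    rw [log_exp, exp_log hs, abs_of_pos (exp_pos _), smul_eq_mul]
    ring
  have hd : ∀ x ∈ Set.univ, HasDerivWithinAt rexp (rexp x) Set.univ x :=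
    fun x _ => (Real.hasDerivAt_exp x).hasDerivWithinAt
  rw [hfun, ← integrableOn_univ, ← setIntegral_univ,
    ← integrableOn_image_iff_integrableOn_abs_deriv_smul MeasurableSet.univ hd exp_injective.injOn
      (fun p => spectralDensity ν θ (log p) / (p + s)),
    ← integral_image_eq_integral_abs_deriv_smul MeasurableSet.univ hd exp_injective.injOn
      (fun p => spectralDensity ν θ (log p) / (p + s)), Set.image_univ, range_exp] at h
  exact h

lemma lintegral_laplace_rtheta [IsFiniteMeasure μ] (hμ : IsDistOrderMeasure μ) {θ : ℝ}
    (hθ : 0 ≤ θ) {s : ℝ} (hs : 0 < s) :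
    ∫⁻ t in Set.Ioi (0:ℝ), ENNReal.ofReal (rexp (-(s * t)) * rtheta μ θ t) =
      ENNReal.ofReal (θ + mgf id μ (log s))⁻¹ := by
  have hν := hμ.ae_mem_Ioo
  have h := integral_spectralDensity_log_stieltjes hν hμ.1 hθ hs
  rw [rtheta_eq_laplaceKernel hμ, lintegral_laplace_laplaceKernel
    (continuousOn_spectralDensity_log hν hμ.1 hθ)
    (fun p _ => spectralDensity_nonneg hν hμ.1 θ _)
    (integral_spectralDensity_log_stieltjes hν hμ.1 hθ one_pos).1 hs,
    ← ofReal_integral_eq_lintegral_ofReal (h.1.const_mul _), integral_const_mul, h.2]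
  · congr 1
    field_simp
  · filter_upwards [ae_restrict_mem measurableSet_Ioi] with p (hp : 0 < p)
    have := spectralDensity_nonneg hν hμ.1 θ (log p)
    simp only [Pi.zero_apply]
    positivity

end Resolvent

/-- For every `θ ≥ 0`, the function `r_θ` solves the resolvent equation associated with `l`:
`r_θ(t) + θ (r_θ ∗ l)(t) = l(t)` for every `t > 0`. -/
theorem statement6 (μ : Measure ℝ) [IsFiniteMeasure μ] (hμ : IsDistOrderMeasure μ) :
    ∀ θ ≥ (0:ℝ), ∀ t > (0:ℝ),
      rtheta μ θ t + θ * ∫ τ in (0:ℝ)..t, rtheta μ θ (t - τ) * lker μ τ = lker μ t := by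
  intro θ hθ t ht
  have hν := hμ.ae_mem_Ioo
  have hcont : ∀ η ≥ 0, ContinuousOn (rtheta μ η) (Set.Ioi 0) := fun η hη => by
    rw [rtheta_eq_laplaceKernel hμ]
    exact continuousOn_laplaceKernel (continuousOn_spectralDensity_log hν hμ.1 hη)
      (fun p _ => spectralDensity_nonneg hν hμ.1 η _)
      (integral_spectralDensity_log_stieltjes hν hμ.1 hη one_pos).1
  have hanti : ∀ η ≥ 0, AntitoneOn (rtheta μ η) (Set.Ioi 0) := fun η hη => by
    rw [rtheta_eq_laplaceKernel hμ]
    exact antitoneOn_laplaceKernel (continuousOn_spectralDensity_log hν hμ.1 hη)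
      (fun p _ => spectralDensity_nonneg hν hμ.1 η _)
      (integral_spectralDensity_log_stieltjes hν hμ.1 hη one_pos).1
  have hnn : ∀ η ≥ 0, ∀ x > 0, 0 ≤ rtheta μ η x := fun η hη x _ => by
    rw [rtheta_eq_laplaceKernel hμ]
    exact laplaceKernel_nonneg (fun p _ => spectralDensity_nonneg hν hμ.1 η _) x
  have hlap : ∀ η ≥ 0, ∀ s > 0,
      ∫⁻ x in Set.Ioi (0:ℝ), ENNReal.ofReal (rexp (-(s * x)) * rtheta μ η x) =
        ENNReal.ofReal (η + mgf id μ (log s))⁻¹ :=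
    fun η hη s hs => lintegral_laplace_rtheta hμ hη hs
  have hii : ∀ η ≥ 0, ∀ x > 0, IntervalIntegrable (rtheta μ η) volume 0 x := fun η hη x hx =>
    intervalIntegrable_of_lintegral_laplace_ne_top (hcont η hη) (hnn η hη)
      (by rw [hlap η hη 1 one_pos]; exact ENNReal.ofReal_ne_top) hx
  rw [lker_eq_rtheta_zero]
  set u := rtheta μ θ
  set l := rtheta μ 0
  have hconv : ContinuousOn (fun x => ∫ τ in (0:ℝ)..x, u (x - τ) * l τ) (Set.Ioi 0) :=
    continuousOn_convolution (hcont θ hθ) (hcont 0 le_rfl) (hnn θ hθ) (hnn 0 le_rfl)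
      (hanti θ hθ) (hanti 0 le_rfl) (hii θ hθ) (hii 0 le_rfl)
  have hconv0 : ∀ x > 0, 0 ≤ ∫ τ in (0:ℝ)..x, u (x - τ) * l τ := fun x hx => by
    rw [intervalIntegral.integral_of_le hx.le, ← restrict_Ioo_eq_restrict_Ioc]
    exact setIntegral_nonneg measurableSet_Ioo fun τ hτ =>
      mul_nonneg (hnn θ hθ _ (sub_pos.2 hτ.2)) (hnn 0 le_rfl _ hτ.1)
  have hadd : ∀ s > 0, ∫⁻ x in Set.Ioi (0:ℝ), ENNReal.ofReal (rexp (-(s * x)) *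
      (u x + θ * ∫ τ in (0:ℝ)..x, u (x - τ) * l τ)) =
      ENNReal.ofReal (0 + mgf id μ (log s))⁻¹ := fun s hs => by
    have hsplit : ∀ x ∈ Set.Ioi (0:ℝ), ENNReal.ofReal (rexp (-(s * x)) *
        (u x + θ * ∫ τ in (0:ℝ)..x, u (x - τ) * l τ)) =
        ENNReal.ofReal (rexp (-(s * x)) * u x) + ENNReal.ofReal θ *
          ENNReal.ofReal (rexp (-(s * x)) * ∫ τ in (0:ℝ)..x, u (x - τ) * l τ) := fun x hx => by
      rw [← ENNReal.ofReal_mul hθ, ← ENNReal.ofReal_add]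
      · ring_nf
      · exact mul_nonneg (exp_pos _).le (hnn θ hθ x hx)
      · exact mul_nonneg hθ (mul_nonneg (exp_pos _).le (hconv0 x hx))
    have hmeas : ∀ {f : ℝ → ℝ}, ContinuousOn f (Set.Ioi 0) →
        AEMeasurable (fun x => ENNReal.ofReal (rexp (-(s * x)) * f x))
          (volume.restrict (Set.Ioi 0)) := fun {f} hf => by
      have hc : ContinuousOn (fun x => rexp (-(s * x)) * f x) (Set.Ioi 0) := by fun_prop
      exact (hc.aemeasurable measurableSet_Ioi).ennreal_ofReal
    have hpos : 0 < mgf id μ (log s) :=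
      integral_pos_of_ae_mem_Ioo hν hμ.1 (integrable_exp_mul_of_ae_mem_Ioo hν _)
        fun _ _ => exp_pos _
    rw [setLIntegral_congr_fun measurableSet_Ioi hsplit, lintegral_add_left' (hmeas (hcont θ hθ)),
      lintegral_const_mul'' _ (hmeas hconv),
      lintegral_laplace_convolution (hcont θ hθ) (hcont 0 le_rfl) (hnn θ hθ) (hnn 0 le_rfl)
        (fun x hx => intervalIntegrable_convolution (hcont θ hθ) (hcont 0 le_rfl) (hnn θ hθ)
          (hnn 0 le_rfl) (hanti θ hθ) (hanti 0 le_rfl) hx (hii θ hθ x hx) (hii 0 le_rfl x hx)),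
      hlap θ hθ s hs, hlap 0 le_rfl s hs, ← ENNReal.ofReal_mul (by positivity),
      ← ENNReal.ofReal_mul hθ, ← ENNReal.ofReal_add (by positivity) (by positivity)]
    congr 1
    have : θ + mgf id μ (log s) ≠ 0 := by positivity
    rw [zero_add]
    field_simp
    ring
  refine eqOn_of_laplace_eq
    (f := fun x => u x + θ * ∫ τ in (0:ℝ)..x, u (x - τ) * l τ) (g := l)
    ((hcont θ hθ).add (continuousOn_const.mul hconv)) (hcont 0 le_rfl)
    (fun x hx => add_nonneg (hnn θ hθ x hx) (mul_nonneg hθ (hconv0 x hx))) (hnn 0 le_rfl)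
    (fun s hs => ?_) (fun s hs => ?_) ht
  · rw [hadd s hs]
    exact ENNReal.ofReal_ne_top
  · rw [hadd s hs, hlap 0 le_rfl s hs]
end

section
/- For every r > 0 and every λ ∈ (0,1] one has Φ(λ r) ≤ λ² Φ(r). -/
open MeasureTheory Real

/-- The function `k₁(t) = ∫_{(0,1]} t^{−α} dμ(α)`. -/
noncomputable def k1 (μ : Measure ℝ) (t : ℝ) : ℝ :=
  ∫ a in Set.Ioc (0:ℝ) 1, t ^ (-a) ∂μ

/-- `a ↦ t ^ (-a)` is integrable on `(0,1]` for every finite measure and every `t > 0`. -/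
lemma integrableOn_rpow_neg (μ : Measure ℝ) [IsFiniteMeasure μ] {t : ℝ} (ht : 0 < t) :
    IntegrableOn (fun a : ℝ => t ^ (-a)) (Set.Ioc 0 1) μ := by
  have hc : Continuous fun a : ℝ => t ^ (-a) :=
    continuous_const.rpow continuous_neg fun _ => Or.inl ht.ne'
  exact (hc.continuousOn.integrableOn_compact isCompact_Icc).mono_set Set.Ioc_subset_Icc_self

/-- Scaling bound: `k₁(c t) ≤ c⁻¹ k₁(t)` for `0 < c ≤ 1`. -/
lemma k1_mul_le (μ : Measure ℝ) [IsFiniteMeasure μ] {c t : ℝ} (hc : 0 < c) (hc1 : c ≤ 1)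
    (ht : 0 < t) : k1 μ (c * t) ≤ c⁻¹ * k1 μ t := by
  unfold k1
  rw [← integral_const_mul]
  refine setIntegral_mono_on (integrableOn_rpow_neg μ (mul_pos hc ht))
    ((integrableOn_rpow_neg μ ht).const_mul _) measurableSet_Ioc fun a ha => ?_
  rw [Real.mul_rpow hc.le ht.le, ← Real.rpow_neg_one c]
  exact mul_le_mul_of_nonneg_right
    (Real.rpow_le_rpow_of_exponent_ge hc hc1 (neg_le_neg ha.2)) (Real.rpow_nonneg ht.le _)

/-- For every `r > 0` and every `λ ∈ (0,1]` one has `Φ(λ r) ≤ λ² Φ(r)`. -/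
theorem statement9 (μ : Measure ℝ) [IsFiniteMeasure μ] (hμ : IsDistOrderMeasure μ)
    (Φ : ℝ → ℝ) (hΦmono : StrictMonoOn Φ (Set.Ici 0))
    (hΦcont : ContinuousOn Φ (Set.Ici 0)) (hΦ0 : Φ 0 = 0)
    (hΦk1 : ∀ r > (0:ℝ), k1 μ (Φ r) = r ^ (-2 : ℝ)) :
    ∀ r > (0:ℝ), ∀ lam ∈ Set.Ioc (0:ℝ) 1, Φ (lam * r) ≤ lam ^ 2 * Φ r := by
  intro r hr lam hlam
  obtain ⟨hl0, hl1⟩ := hlam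
  by_contra! h
  have hlr : 0 < lam * r := mul_pos hl0 hr
  have hs : 0 < Φ r := hΦ0 ▸ hΦmono Set.self_mem_Ici (Set.mem_Ici.2 hr.le) hr
  have hu : 0 < lam ^ 2 * Φ r := by positivity
  obtain ⟨ρ, hρ, hρu⟩ := intermediate_value_Icc hlr.le (hΦcont.mono Set.Icc_subset_Ici_self)
    (show lam ^ 2 * Φ r ∈ Set.Icc (Φ 0) (Φ (lam * r)) from ⟨hΦ0.symm ▸ hu.le, h.le⟩)
  have hρ0 : 0 < ρ := hρ.1.lt_of_ne fun he => by
    rw [← he, hΦ0] at hρu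
    exact hu.ne hρu
  have hρlt : ρ < lam * r := hρ.2.lt_of_ne fun he => by
    rw [he] at hρu
    exact h.ne' hρu
  have hk := k1_mul_le μ (pow_pos hl0 2) (pow_le_one₀ hl0.le hl1) hs
  have hscale : (lam ^ 2)⁻¹ * r ^ (-2 : ℝ) = (lam * r) ^ (-2 : ℝ) := by
    rw [Real.mul_rpow hl0.le hr.le, Real.rpow_neg hl0.le, Real.rpow_two]
  rw [← hρu, hΦk1 ρ hρ0, hΦk1 r hr, hscale] at hk
  exact hk.not_gt (Real.rpow_lt_rpow_of_neg hρ0 hρlt (by norm_num))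
end

section
/- For every p with 1 ≤ p < 1/(1−γ₋) there exist constants r* = r*(μ,p) > 0 and C = C(μ,p) > 0 such that Φ(2r*) ≤ 1 and for every r ∈ (0, r*] one has (∫₀^{Φ(2r)} l(τ)^p dτ) · Φ(2r)^{p−1} ≤ C r^{2p}. -/
open MeasureTheory Real

/-- The symbol `∫_{(0,1]} r^α dμ(α)` of the distributed-order operator. -/
noncomputable def distSymbol (μ : Measure ℝ) (r : ℝ) : ℝ :=
  ∫ a in Set.Ioc (0:ℝ) 1, r ^ a ∂μ

lemma k1_eq_distSymbol_inv (μ : Measure ℝ) {t : ℝ} (ht : 0 < t) :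
    k1 μ t = distSymbol μ t⁻¹ := by
  unfold k1 distSymbol
  congr 1
  ext a
  rw [Real.inv_rpow ht.le, Real.rpow_neg ht.le]

lemma rpow_le_one_add_self {x a : ℝ} (hx : 0 ≤ x) (ha : a ∈ Set.Icc (0:ℝ) 1) :
    x ^ a ≤ 1 + x := by
  rcases le_total x 1 with h | h
  · linarith [Real.rpow_le_one hx h ha.1]
  · have := Real.rpow_le_rpow_of_exponent_le h ha.2
    rw [Real.rpow_one] at this
    linarith

lemma integrableOn_rpow_mul (μ : Measure ℝ) [IsFiniteMeasure μ] {r : ℝ} (hr : 0 < r)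
    {f : ℝ → ℝ} (hf : Continuous f) (hf1 : ∀ a ∈ Set.Ioc (0:ℝ) 1, |f a| ≤ 1) :
    IntegrableOn (fun a => r ^ a * f a) (Set.Ioc 0 1) μ := by
  have hc : Continuous fun a : ℝ => r ^ a * f a :=
    (Real.continuous_const_rpow hr.ne').mul hf
  refine Integrable.of_bound hc.aestronglyMeasurable (1 + r) ?_
  filter_upwards [ae_restrict_mem measurableSet_Ioc] with a ha
  have h0 : 0 ≤ r ^ a := Real.rpow_nonneg hr.le _
  rw [Real.norm_eq_abs, abs_mul, abs_of_nonneg h0]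
  have h1 := rpow_le_one_add_self hr.le (Set.Ioc_subset_Icc_self ha)
  have h2 := hf1 a ha
  nlinarith [abs_nonneg (f a)]

lemma integrableOn_rpow (μ : Measure ℝ) [IsFiniteMeasure μ] {r : ℝ} (hr : 0 < r) :
    IntegrableOn (fun a => r ^ a) (Set.Ioc 0 1) μ := by
  simpa using integrableOn_rpow_mul μ hr (f := fun _ => 1) continuous_const (by simp)

lemma hasDerivAt_distSymbol (μ : Measure ℝ) [IsFiniteMeasure μ] {r : ℝ} (hr : 0 < r) :
    HasDerivAt (distSymbol μ) (∫ a in Set.Ioc (0:ℝ) 1, a * r ^ (a - 1) ∂μ) r := by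
  have hs : Set.Ioo (r / 2) (2 * r) ∈ nhds r := Ioo_mem_nhds (by linarith) (by linarith)
  refine (hasDerivAt_integral_of_dominated_loc_of_deriv_le
    (F := fun x a : ℝ => x ^ a) (F' := fun x a : ℝ => a * x ^ (a - 1))
    (bound := fun _ => (1 + 2 * r) / (r / 2)) hs ?_ (integrableOn_rpow μ hr) ?_ ?_
    (integrable_const _) ?_).2
  · filter_upwards [hs] with x hx
    exact (Real.continuous_const_rpow (by linarith [hx.1] : (0:ℝ) < x).ne').aestronglyMeasurable
  · exact (continuous_id.mul ((Real.continuous_const_rpow hr.ne').comp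
      (continuous_id.sub continuous_const))).aestronglyMeasurable
  · filter_upwards [ae_restrict_mem measurableSet_Ioc] with a ha x hx
    have hx0 : 0 < x := by linarith [hx.1]
    have h1 := rpow_le_one_add_self hx0.le (Set.Ioc_subset_Icc_self ha)
    have h2 : 0 ≤ x ^ a := Real.rpow_nonneg hx0.le _
    rw [Real.norm_eq_abs, abs_of_nonneg (mul_nonneg ha.1.le (Real.rpow_nonneg hx0.le _)),
      Real.rpow_sub hx0, Real.rpow_one]
    calc a * (x ^ a / x) ≤ 1 * (x ^ a / x) := by gcongr; exact ha.2
      _ = x ^ a / x := one_mul _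
      _ ≤ (1 + 2 * r) / (r / 2) := by
        gcongr
        · linarith [hx.2]
        · exact hx.1.le
  · filter_upwards with a x hx
    exact Real.hasDerivAt_rpow_const (Or.inl (by linarith [hx.1] : (0:ℝ) < x).ne')

lemma measureReal_Ioc_mul_rpow_le (μ : Measure ℝ) [IsFiniteMeasure μ] {γ r : ℝ}
    (hγ : 0 ≤ γ) (hr : 1 ≤ r) :
    μ.real (Set.Ioc γ 1) * r ^ γ ≤ ∫ a in Set.Ioc γ 1, r ^ a ∂μ := by
  rw [← smul_eq_mul, ← setIntegral_const]
  refine setIntegral_mono_on integrableOn_const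
    ((integrableOn_rpow μ (by linarith)).mono_set (Set.Ioc_subset_Ioc_left hγ))
    measurableSet_Ioc fun a ha => ?_
  exact Real.rpow_le_rpow_of_exponent_le hr ha.1.le

lemma setIntegral_Ioc_le_distSymbol (μ : Measure ℝ) [IsFiniteMeasure μ] {γ r : ℝ}
    (hγ : 0 ≤ γ) (hr : 0 < r) :
    ∫ a in Set.Ioc γ 1, r ^ a ∂μ ≤ distSymbol μ r :=
  setIntegral_mono_set (integrableOn_rpow μ hr)
    (ae_of_all _ fun _ => Real.rpow_nonneg hr.le _) (Set.Ioc_subset_Ioc_left hγ).eventuallyLE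

lemma distSymbol_le_setIntegral_Ioc (μ : Measure ℝ) [IsFiniteMeasure μ] {γ r : ℝ}
    (hγ : γ ∈ Set.Ioo (0:ℝ) 1) (hγμ : 0 < μ.real (Set.Ioc γ 1)) (hr : 1 ≤ r) :
    distSymbol μ r ≤
      μ.real (Set.Ioc 0 1) / μ.real (Set.Ioc γ 1) * ∫ a in Set.Ioc γ 1, r ^ a ∂μ := by
  have hr0 : 0 < r := by linarith
  have hint := integrableOn_rpow μ hr0
  have hu : Set.Ioc (0:ℝ) γ ∪ Set.Ioc γ 1 = Set.Ioc 0 1 :=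
    Set.Ioc_union_Ioc_eq_Ioc hγ.1.le hγ.2.le
  have hd : Disjoint (Set.Ioc (0:ℝ) γ) (Set.Ioc γ 1) := Set.Ioc_disjoint_Ioc_of_le le_rfl
  have hsplit : distSymbol μ r =
      ∫ a in Set.Ioc 0 γ, r ^ a ∂μ + ∫ a in Set.Ioc γ 1, r ^ a ∂μ := by
    rw [distSymbol, ← hu]
    exact setIntegral_union hd measurableSet_Ioc
      (hint.mono_set (Set.Ioc_subset_Ioc_right hγ.2.le))
      (hint.mono_set (Set.Ioc_subset_Ioc_left hγ.1.le))
  have hM : μ.real (Set.Ioc 0 1) = μ.real (Set.Ioc 0 γ) + μ.real (Set.Ioc γ 1) := by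
    rw [← hu]; exact measureReal_union hd measurableSet_Ioc
  have hlow : ∫ a in Set.Ioc 0 γ, r ^ a ∂μ ≤ μ.real (Set.Ioc 0 γ) * r ^ γ := by
    rw [← smul_eq_mul, ← setIntegral_const]
    exact setIntegral_mono_on (hint.mono_set (Set.Ioc_subset_Ioc_right hγ.2.le))
      integrableOn_const measurableSet_Ioc
      fun a ha => Real.rpow_le_rpow_of_exponent_le hr ha.2
  have hhigh := measureReal_Ioc_mul_rpow_le μ hγ.1.le hr
  rw [hsplit, div_mul_eq_mul_div, le_div_iff₀ hγμ, hM]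
  have := measureReal_nonneg (μ := μ) (s := Set.Ioc 0 γ)
  nlinarith

lemma distSymbol_pos (μ : Measure ℝ) [IsFiniteMeasure μ] {r : ℝ}
    (hμ : 0 < μ.real (Set.Ioc 0 1)) (hr : 0 < r) : 0 < distSymbol μ r := by
  refine (setIntegral_pos_iff_support_of_nonneg_ae
    (ae_of_all _ fun _ => Real.rpow_nonneg hr.le _) (integrableOn_rpow μ hr)).2 ?_
  have : Function.support (fun a : ℝ => r ^ a) = Set.univ := by
    ext a; simp [(Real.rpow_pos_of_pos hr a).ne']
  rw [this, Set.univ_inter]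
  exact (ENNReal.toReal_pos_iff.1 hμ).1

/-- Almost-monotonicity of `r ↦ r^{-γ} distSymbol μ r`. -/
lemma distSymbol_le_of_le (μ : Measure ℝ) [IsFiniteMeasure μ] {γ r R : ℝ}
    (hγ : γ ∈ Set.Ioo (0:ℝ) 1) (hγμ : 0 < μ.real (Set.Ioc γ 1)) (hR : 1 ≤ R) (hRr : R ≤ r) :
    (r / R) ^ γ * distSymbol μ R ≤
      μ.real (Set.Ioc 0 1) / μ.real (Set.Ioc γ 1) * distSymbol μ r := by
  have hR0 : 0 < R := by linarith
  have hr0 : 0 < r := by linarith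
  have hq : 1 ≤ r / R := (one_le_div hR0).2 hRr
  have h1 : (r / R) ^ γ * ∫ a in Set.Ioc γ 1, R ^ a ∂μ ≤ ∫ a in Set.Ioc γ 1, r ^ a ∂μ := by
    rw [← integral_const_mul]
    refine setIntegral_mono_on
      (((integrableOn_rpow μ hR0).mono_set (Set.Ioc_subset_Ioc_left hγ.1.le)).const_mul _)
      ((integrableOn_rpow μ hr0).mono_set (Set.Ioc_subset_Ioc_left hγ.1.le))
      measurableSet_Ioc fun a ha => ?_
    calc (r / R) ^ γ * R ^ a ≤ (r / R) ^ a * R ^ a := by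
          gcongr
          exact ha.1.le
      _ = r ^ a := by rw [← Real.mul_rpow (by positivity) hR0.le, div_mul_cancel₀ _ hR0.ne']
  have h2 := distSymbol_le_setIntegral_Ioc μ hγ hγμ hR
  have h3 := setIntegral_Ioc_le_distSymbol μ hγ.1.le hr0
  have hq0 : 0 ≤ (r / R) ^ γ := by positivity
  have hc : 0 ≤ μ.real (Set.Ioc 0 1) / μ.real (Set.Ioc γ 1) := by positivity
  calc _ ≤ (r / R) ^ γ * (μ.real (Set.Ioc 0 1) / μ.real (Set.Ioc γ 1) *
        ∫ a in Set.Ioc γ 1, R ^ a ∂μ) := by gcongr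
    _ = μ.real (Set.Ioc 0 1) / μ.real (Set.Ioc γ 1) *
        ((r / R) ^ γ * ∫ a in Set.Ioc γ 1, R ^ a ∂μ) := by ring
    _ ≤ _ := by gcongr; exact h1.trans h3

lemma integral_rpow_mul_sin_bounds (μ : Measure ℝ) [IsFiniteMeasure μ] {r : ℝ} (hr : 0 < r) :
    0 ≤ ∫ a in Set.Ioc (0:ℝ) 1, r ^ a * Real.sin (π * a) ∂μ ∧
    ∫ a in Set.Ioc (0:ℝ) 1, r ^ a * Real.sin (π * a) ∂μ ≤ distSymbol μ r ∧
    ∫ a in Set.Ioc (0:ℝ) 1, r ^ a * Real.sin (π * a) ∂μ ≤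
      π * ∫ a in Set.Ioc (0:ℝ) 1, r ^ a * (1 - a) ∂μ := by
  have hS := integrableOn_rpow_mul μ hr (f := fun a => Real.sin (π * a)) (by fun_prop)
    (fun a _ => Real.abs_sin_le_one _)
  refine ⟨setIntegral_nonneg measurableSet_Ioc fun a ha => ?_,
    setIntegral_mono_on hS (integrableOn_rpow μ hr) measurableSet_Ioc fun a ha => ?_, ?_⟩
  · exact mul_nonneg (Real.rpow_nonneg hr.le _) (Real.sin_nonneg_of_nonneg_of_le_pi
      (mul_nonneg pi_pos.le ha.1.le) (by nlinarith [pi_pos, ha.2]))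
  · exact mul_le_of_le_one_right (Real.rpow_nonneg hr.le _) (Real.sin_le_one _)
  · rw [← integral_const_mul]
    refine setIntegral_mono_on hS ((integrableOn_rpow_mul μ hr (f := fun a => 1 - a)
      (by fun_prop) fun a ha => ?_).const_mul _) measurableSet_Ioc fun a ha => ?_
    · rw [abs_le]; constructor <;> linarith [ha.1, ha.2]
    · have : Real.sin (π * a) ≤ π * (1 - a) := by
        rw [← Real.sin_pi_sub, show π - π * a = π * (1 - a) by ring]
        exact Real.sin_le (mul_nonneg pi_pos.le (by linarith [ha.2]))
      nlinarith [Real.rpow_nonneg hr.le a]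

lemma Hker_nonneg (μ : Measure ℝ) [IsFiniteMeasure μ] {r : ℝ} (hr : 0 < r) : 0 ≤ Hker μ r :=
  div_nonneg (integral_rpow_mul_sin_bounds μ hr).1 (by positivity)

/-- The derivative of `r ↦ r / distSymbol μ r`, which for large `r` dominates `Hker μ r` up to a
constant, see `exists_Hker_le`. -/
lemma hasDerivAt_div_distSymbol (μ : Measure ℝ) [IsFiniteMeasure μ]
    (hμ : 0 < μ.real (Set.Ioc 0 1)) {r : ℝ} (hr : 0 < r) :
    HasDerivAt (fun x => x / distSymbol μ x)
      ((∫ a in Set.Ioc (0:ℝ) 1, r ^ a * (1 - a) ∂μ) / distSymbol μ r ^ 2) r := by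
  refine ((hasDerivAt_id' r).div (hasDerivAt_distSymbol μ hr)
    (distSymbol_pos μ hμ hr).ne').congr_deriv ?_
  congr 1
  have ha := integrableOn_rpow_mul μ hr (f := fun a => a) continuous_id fun a ha => by
    rw [abs_le]; constructor <;> linarith [ha.1, ha.2]
  rw [one_mul, ← integral_const_mul, distSymbol, ← integral_sub (integrableOn_rpow μ hr)]
  · congr 1
    ext a
    rw [Real.rpow_sub hr, Real.rpow_one]
    field_simp
  · refine ha.congr (ae_of_all _ fun a => ?_)
    beta_reduce
    rw [Real.rpow_sub hr, Real.rpow_one]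
    field_simp

lemma exists_distSymbol_sq_le (μ : Measure ℝ) [IsFiniteMeasure μ] {γ : ℝ}
    (hγ : γ ∈ Set.Ioo (0:ℝ) 1) (hγμ : 0 < μ.real (Set.Ioc γ 1)) :
    ∃ r₀ : ℝ, 1 ≤ r₀ ∧ ∃ c : ℝ, 0 < c ∧ ∀ r ≥ r₀, c * distSymbol μ r ^ 2 ≤
      (∫ a in Set.Ioc (0:ℝ) 1, r ^ a * Real.sin (π * a) ∂μ) ^ 2 +
      (∫ a in Set.Ioc (0:ℝ) 1, r ^ a * Real.cos (π * a) ∂μ) ^ 2 := by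
  set m := μ.real (Set.Ioc γ 1) with hm
  set M := μ.real (Set.Ioc 0 1) with hM
  have hmM : m ≤ M := measureReal_mono (Set.Ioc_subset_Ioc_left hγ.1.le)
  have hMpos : 0 < M := hγμ.trans_le hmM
  set s := Real.sin (π * (γ / 2)) with hs
  have hspos : 0 < s := Real.sin_pos_of_pos_of_lt_pi (by have := hγ.1; positivity)
    (by nlinarith [pi_pos, hγ.2])
  obtain ⟨r₀, hr₀⟩ := Filter.eventually_atTop.1
    (((tendsto_rpow_atTop (half_pos hγ.1)).eventually_ge_atTop (2 * M / (s * m))).and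
      (Filter.eventually_ge_atTop 1))
  refine ⟨max r₀ 1, le_max_right _ _, (s / 2 * (m / M)) ^ 2, by positivity, fun r hr => ?_⟩
  obtain ⟨hlarge, hr1⟩ := hr₀ r ((le_max_left _ _).trans hr)
  have hr0 : 0 < r := by linarith
  have hint := integrableOn_rpow μ hr0
  have hS := integrableOn_rpow_mul μ hr0 (f := fun a => Real.sin (π * a)) (by fun_prop)
    (fun a _ => Real.abs_sin_le_one _)
  have hC := integrableOn_rpow_mul μ hr0 (f := fun a => Real.cos (π * a)) (by fun_prop)
    (fun a _ => Real.abs_cos_le_one _)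
  set S := ∫ a in Set.Ioc (0:ℝ) 1, r ^ a * Real.sin (π * a) ∂μ with hSdef
  set C := ∫ a in Set.Ioc (0:ℝ) 1, r ^ a * Real.cos (π * a) ∂μ with hCdef
  set P := ∫ a in Set.Ioc γ 1, r ^ a ∂μ with hPdef
  have hrot : s * P - M * r ^ (γ / 2) ≤
      S * Real.cos (π * (γ / 2)) - C * Real.sin (π * (γ / 2)) := by
    have h1 : s * P - M * r ^ (γ / 2) =
        ∫ a in Set.Ioc (0:ℝ) 1, ((Set.Ioc γ 1).indicator (fun a => s * r ^ a) a -
          r ^ (γ / 2)) ∂μ := by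
      rw [integral_sub, setIntegral_indicator measurableSet_Ioc, integral_const_mul,
        setIntegral_const, smul_eq_mul, Set.inter_eq_right.2 (Set.Ioc_subset_Ioc_left hγ.1.le)]
      · exact (hint.const_mul s).indicator measurableSet_Ioc
      · exact integrable_const _
    rw [h1, hSdef, hCdef, ← integral_mul_const, ← integral_mul_const, ← integral_sub
      (hS.mul_const _) (hC.mul_const _)]
    refine setIntegral_mono_on (((hint.const_mul s).indicator measurableSet_Ioc).sub
      (integrable_const _)) ((hS.mul_const _).sub (hC.mul_const _)) measurableSet_Ioc
      fun a ha => ?_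
    have hsub : r ^ a * Real.sin (π * a) * Real.cos (π * (γ / 2)) -
        r ^ a * Real.cos (π * a) * Real.sin (π * (γ / 2)) =
        r ^ a * Real.sin (π * a - π * (γ / 2)) := by rw [Real.sin_sub]; ring
    rw [hsub]
    have ha0 : 0 < r ^ a := Real.rpow_pos_of_pos hr0 a
    have hg0 : 0 < r ^ (γ / 2) := Real.rpow_pos_of_pos hr0 _
    by_cases haγ : a ∈ Set.Ioc γ 1
    · rw [Set.indicator_of_mem haγ]
      have : s ≤ Real.sin (π * a - π * (γ / 2)) := by
        rw [hs, ← Real.cos_pi_div_two_sub, ← Real.cos_pi_div_two_sub,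
          ← Real.cos_abs (π / 2 - (π * a - π * (γ / 2)))]
        refine Real.cos_le_cos_of_nonneg_of_le_pi (abs_nonneg _)
          (by nlinarith [pi_pos, hγ.1]) (abs_le.2 ⟨?_, ?_⟩)
        · nlinarith [pi_pos, haγ.2]
        · nlinarith [pi_pos, haγ.1]
      nlinarith
    · rw [Set.indicator_of_notMem haγ]
      have haγ' : a ≤ γ := by
        by_contra h
        exact haγ ⟨not_le.1 h, ha.2⟩
      rcases le_total a (γ / 2) with h | h
      · have h2 := Real.rpow_le_rpow_of_exponent_le hr1 h
        nlinarith [Real.neg_one_le_sin (π * a - π * (γ / 2))]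
      · have : 0 ≤ Real.sin (π * a - π * (γ / 2)) :=
          Real.sin_nonneg_of_nonneg_of_le_pi (by nlinarith [pi_pos])
            (by nlinarith [pi_pos, hγ.1, ha.2])
        nlinarith [mul_nonneg ha0.le this]
  have hPlow : m * (r ^ (γ / 2) * r ^ (γ / 2)) ≤ P := by
    rw [← Real.rpow_add hr0, add_halves]
    exact measureReal_Ioc_mul_rpow_le μ hγ.1.le hr1
  have hsmall : M * r ^ (γ / 2) ≤ s / 2 * P := by
    rw [div_le_iff₀ (by positivity)] at hlarge
    have hg0 : 0 < r ^ (γ / 2) := Real.rpow_pos_of_pos hr0 _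
    calc M * r ^ (γ / 2) = 2 * M * r ^ (γ / 2) / 2 := by ring
      _ ≤ r ^ (γ / 2) * (s * m) * r ^ (γ / 2) / 2 := by gcongr
      _ = s / 2 * (m * (r ^ (γ / 2) * r ^ (γ / 2))) := by ring
      _ ≤ s / 2 * P := by gcongr
  have hKP : m / M * distSymbol μ r ≤ P := by
    have := distSymbol_le_setIntegral_Ioc μ hγ hγμ hr1
    calc m / M * distSymbol μ r ≤ m / M * (M / m * P) := by gcongr
      _ = P := by field_simp
  have hK := (distSymbol_pos μ hMpos hr0).le
  have hfin : s / 2 * (m / M) * distSymbol μ r ≤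
      S * Real.cos (π * (γ / 2)) - C * Real.sin (π * (γ / 2)) := by
    nlinarith
  have hsq := pow_le_pow_left₀ (by positivity) hfin 2
  have htrig := Real.sin_sq_add_cos_sq (π * (γ / 2))
  calc _ = (s / 2 * (m / M) * distSymbol μ r) ^ 2 := by ring
    _ ≤ _ := hsq
    _ ≤ (S * Real.cos (π * (γ / 2)) - C * Real.sin (π * (γ / 2))) ^ 2 +
        (S * Real.sin (π * (γ / 2)) + C * Real.cos (π * (γ / 2))) ^ 2 :=
      le_add_of_nonneg_right (sq_nonneg _)
    _ = (S ^ 2 + C ^ 2) * (Real.sin (π * (γ / 2)) ^ 2 + Real.cos (π * (γ / 2)) ^ 2) := by ring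
    _ = S ^ 2 + C ^ 2 := by rw [htrig, mul_one]

lemma exists_Hker_le (μ : Measure ℝ) [IsFiniteMeasure μ] {γ : ℝ}
    (hγ : γ ∈ Set.Ioo (0:ℝ) 1) (hγμ : 0 < μ.real (Set.Ioc γ 1)) :
    ∃ r₀ : ℝ, 1 ≤ r₀ ∧ ∃ A : ℝ, 0 < A ∧ ∀ r ≥ r₀, Hker μ r ≤ A / distSymbol μ r ∧
      Hker μ r ≤ A * ((∫ a in Set.Ioc (0:ℝ) 1, r ^ a * (1 - a) ∂μ) / distSymbol μ r ^ 2) := by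
  have hMpos : 0 < μ.real (Set.Ioc 0 1) :=
    hγμ.trans_le (measureReal_mono (Set.Ioc_subset_Ioc_left hγ.1.le))
  obtain ⟨r₀, hr₀, c, hc, h⟩ := exists_distSymbol_sq_le μ hγ hγμ
  refine ⟨r₀, hr₀, π / c, by positivity, fun r hr => ?_⟩
  have hr0 : 0 < r := by linarith
  have hK := distSymbol_pos μ hMpos hr0
  obtain ⟨hS0, hSK, hSD⟩ := integral_rpow_mul_sin_bounds μ hr0
  have hH := div_le_div_of_nonneg_left hS0 (by positivity) (h r hr)
  refine ⟨hH.trans ?_, hH.trans ?_⟩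
  · calc _ ≤ distSymbol μ r / (c * distSymbol μ r ^ 2) := by gcongr
      _ = 1 / c / distSymbol μ r := by field_simp
      _ ≤ _ := by gcongr; linarith [pi_gt_three]
  · calc _ ≤ (π * ∫ a in Set.Ioc (0:ℝ) 1, r ^ a * (1 - a) ∂μ) / (c * distSymbol μ r ^ 2) := by
          gcongr
      _ = _ := by field_simp

lemma distSymbol_mono (μ : Measure ℝ) [IsFiniteMeasure μ] {r R : ℝ} (hr : 0 < r) (hrR : r ≤ R) :
    distSymbol μ r ≤ distSymbol μ R :=
  setIntegral_mono_on (integrableOn_rpow μ hr) (integrableOn_rpow μ (hr.trans_le hrR))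
    measurableSet_Ioc fun _ ha => Real.rpow_le_rpow hr.le hrR ha.1.le

lemma lker_nonneg (μ : Measure ℝ) [IsFiniteMeasure μ] (t : ℝ) : 0 ≤ lker μ t :=
  mul_nonneg (by positivity) (setIntegral_nonneg measurableSet_Ioi fun _ hr =>
    mul_nonneg (Real.exp_pos _).le (Hker_nonneg μ hr))

/-- The kernel satisfies `l(t) ≤ B / (t k₁(t))` for small `t = 1 / R`. -/
lemma exists_lker_inv_le (μ : Measure ℝ) [IsFiniteMeasure μ] {γ : ℝ}
    (hγ : γ ∈ Set.Ioo (0:ℝ) 1) (hγμ : 0 < μ.real (Set.Ioc γ 1)) :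
    ∃ r₀ : ℝ, 1 ≤ r₀ ∧ ∃ B : ℝ, 0 < B ∧ ∀ R ≥ r₀, lker μ R⁻¹ ≤ B * (R / distSymbol μ R) := by
  have hMpos : 0 < μ.real (Set.Ioc 0 1) :=
    hγμ.trans_le (measureReal_mono (Set.Ioc_subset_Ioc_left hγ.1.le))
  obtain ⟨r₀, hr₀, A, hA, hH⟩ := exists_Hker_le μ hγ hγμ
  have hr₀pos : 0 < r₀ := by linarith
  set E := ∫ r in Set.Ioc 0 r₀, Hker μ r with hE
  have hE0 : 0 ≤ E := setIntegral_nonneg measurableSet_Ioc fun r hr => Hker_nonneg μ hr.1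
  set G := r₀ / distSymbol μ r₀ with hG
  have hG0 : 0 < G := div_pos hr₀pos (distSymbol_pos μ hMpos hr₀pos)
  refine ⟨r₀, hr₀, 1 / π * (E / G + A + A), by positivity, fun R hR => ?_⟩
  have hR0 : 0 < R := by linarith
  have hKR := distSymbol_pos μ hMpos hR0
  rw [lker, mul_assoc]
  gcongr
  set f : ℝ → ℝ := fun r => Real.exp (-(r * R⁻¹)) * Hker μ r with hf
  have hf0 : ∀ r, 0 < r → 0 ≤ f r := fun r hr =>
    mul_nonneg (Real.exp_pos _).le (Hker_nonneg μ hr)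
  have hfH : ∀ r, 0 < r → f r ≤ Hker μ r := fun r hr =>
    mul_le_of_le_one_left (Hker_nonneg μ hr) (Real.exp_le_one_iff.2 (by
      have : 0 ≤ r * R⁻¹ := by positivity
      linarith))
  by_cases hfi : IntegrableOn f (Set.Ioi 0)
  swap
  · rw [integral_undef hfi]; positivity
  have hderiv : ∀ r, 0 < r → HasDerivAt (fun x => x / distSymbol μ x)
      ((∫ a in Set.Ioc (0:ℝ) 1, r ^ a * (1 - a) ∂μ) / distSymbol μ r ^ 2) r :=
    fun r hr => hasDerivAt_div_distSymbol μ hMpos hr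
  have hcont : ContinuousOn (fun x => x / distSymbol μ x) (Set.Icc r₀ R) := fun x hx =>
    (hderiv x (hr₀pos.trans_le hx.1)).continuousAt.continuousWithinAt
  have hderiv0 : ∀ r, 0 < r →
      0 ≤ (∫ a in Set.Ioc (0:ℝ) 1, r ^ a * (1 - a) ∂μ) / distSymbol μ r ^ 2 := fun r hr =>
    div_nonneg (setIntegral_nonneg measurableSet_Ioc fun a ha =>
      mul_nonneg (Real.rpow_nonneg hr.le _) (by linarith [ha.2])) (by positivity)
  have hDint := intervalIntegral.integrableOn_deriv_of_nonneg hcont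
    (fun x hx => hderiv x (hr₀pos.trans hx.1)) (fun x hx => hderiv0 x (hr₀pos.trans hx.1))
  have hDval := intervalIntegral.integral_eq_sub_of_hasDerivAt_of_le hR hcont
    (fun x hx => hderiv x (hr₀pos.trans hx.1))
    ((intervalIntegrable_iff_integrableOn_Ioc_of_le hR).2 hDint)
  rw [intervalIntegral.integral_of_le hR] at hDval
  have hGR : G ≤ R / distSymbol μ R := by
    have : 0 ≤ R / distSymbol μ R - r₀ / distSymbol μ r₀ := hDval ▸
      setIntegral_nonneg measurableSet_Ioc fun x hx => hderiv0 x (hr₀pos.trans hx.1)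
    linarith
  have h1 : ∫ r in Set.Ioc 0 r₀, f r ≤ E / G * (R / distSymbol μ R) := by
    have hHi : IntegrableOn (Hker μ) (Set.Ioc 0 r₀) := by
      have hf₀ : IntegrableOn f (Set.Ioc 0 r₀) := hfi.mono_set Set.Ioc_subset_Ioi_self
      have hg := hf₀.continuousOn_mul_of_subset (g := fun r : ℝ => Real.exp (r * R⁻¹)) (K := Set.Icc 0 r₀) (by fun_prop)
        isCompact_Icc measurableSet_Ioc Set.Ioc_subset_Icc_self
      refine hg.congr (ae_of_all _ fun r => ?_)
      simp only [hf]
      rw [← mul_assoc, ← Real.exp_add, add_neg_cancel, Real.exp_zero, one_mul]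
    calc ∫ r in Set.Ioc 0 r₀, f r ≤ E :=
          setIntegral_mono_on (hfi.mono_set Set.Ioc_subset_Ioi_self) hHi measurableSet_Ioc
            fun r hr => hfH r hr.1
      _ = E / G * G := by field_simp
      _ ≤ _ := by gcongr
  have h2 : ∫ r in Set.Ioc r₀ R, f r ≤ A * (R / distSymbol μ R) := by
    calc ∫ r in Set.Ioc r₀ R, f r ≤ ∫ r in Set.Ioc r₀ R,
          A * ((∫ a in Set.Ioc (0:ℝ) 1, r ^ a * (1 - a) ∂μ) / distSymbol μ r ^ 2) :=
          setIntegral_mono_on (hfi.mono_set fun x hx => hr₀pos.trans hx.1) (hDint.const_mul A)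
            measurableSet_Ioc fun r hr => (hfH r (hr₀pos.trans hr.1)).trans (hH r hr.1.le).2
      _ = A * (R / distSymbol μ R - G) := by rw [integral_const_mul, hDval]
      _ ≤ _ := by gcongr; linarith
  have h3 : ∫ r in Set.Ioi R, f r ≤ A * (R / distSymbol μ R) := by
    have hneg : -R⁻¹ < 0 := by simpa using hR0
    calc ∫ r in Set.Ioi R, f r ≤ ∫ r in Set.Ioi R,
          Real.exp (-R⁻¹ * r) * (A / distSymbol μ R) := by
          refine setIntegral_mono_on (hfi.mono_set (Set.Ioi_subset_Ioi hR0.le))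
            ((integrableOn_exp_mul_Ioi hneg R).mul_const _) measurableSet_Ioi fun r hr => ?_
          have hRr : R ≤ r := le_of_lt hr
          rw [hf, show -R⁻¹ * r = -(r * R⁻¹) by ring]
          refine mul_le_mul_of_nonneg_left ((hH r (hR.le.trans hRr)).1.trans ?_)
            (Real.exp_pos _).le
          exact div_le_div_of_nonneg_left hA.le hKR (distSymbol_mono μ hR0 hRr)
      _ = Real.exp (-1) * (A * (R / distSymbol μ R)) := by
          rw [integral_mul_const, integral_exp_mul_Ioi hneg, neg_mul, inv_mul_cancel₀ hR0.ne']
          field_simp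
      _ ≤ _ := mul_le_of_le_one_left (by positivity) (Real.exp_le_one_iff.2 (by norm_num))
  have hu1 : Set.Ioc 0 R ∪ Set.Ioi R = Set.Ioi 0 := Set.Ioc_union_Ioi_eq_Ioi hR0.le
  have hu2 : Set.Ioc 0 r₀ ∪ Set.Ioc r₀ R = Set.Ioc 0 R :=
    Set.Ioc_union_Ioc_eq_Ioc hr₀pos.le hR
  rw [← hu1, setIntegral_union (Set.Ioc_disjoint_Ioi le_rfl) measurableSet_Ioi
    (hfi.mono_set Set.Ioc_subset_Ioi_self) (hfi.mono_set (Set.Ioi_subset_Ioi hR0.le)), ← hu2,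
    setIntegral_union (Set.Ioc_disjoint_Ioc_of_le le_rfl) measurableSet_Ioc
    (hfi.mono_set Set.Ioc_subset_Ioi_self) (hfi.mono_set fun x hx => hr₀pos.trans hx.1)]
  linarith

/-- The `L^p` bound on `l` near the origin in terms of `k₁`. -/
lemma exists_integral_lker_rpow_le (μ : Measure ℝ) [IsFiniteMeasure μ] {γ p : ℝ}
    (hγ : γ ∈ Set.Ioo (0:ℝ) 1) (hγμ : 0 < μ.real (Set.Ioc γ 1))
    (hp0 : 0 ≤ p) (hp : p * (1 - γ) < 1) :
    ∃ t₀ : ℝ, 0 < t₀ ∧ t₀ ≤ 1 ∧ ∃ C : ℝ, 0 < C ∧ ∀ T ∈ Set.Ioc 0 t₀,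
      (∫ τ in (0:ℝ)..T, lker μ τ ^ p) * T ^ (p - 1) ≤ C * k1 μ T ^ (-p) := by
  have hMpos : 0 < μ.real (Set.Ioc 0 1) :=
    hγμ.trans_le (measureReal_mono (Set.Ioc_subset_Ioc_left hγ.1.le))
  obtain ⟨r₀, hr₀, B, hB, hl⟩ := exists_lker_inv_le μ hγ hγμ
  set Q := μ.real (Set.Ioc 0 1) / μ.real (Set.Ioc γ 1) with hQ
  have hQ0 : 0 < Q := by positivity
  have hs : 0 < (γ - 1) * p + 1 := by linarith
  refine ⟨r₀⁻¹, by positivity, inv_le_one_of_one_le₀ hr₀,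
    (B * Q) ^ p / ((γ - 1) * p + 1), by positivity, fun T hT => ?_⟩
  have hT0 := hT.1
  have hT1 : r₀ ≤ T⁻¹ := (le_inv_comm₀ (by linarith) hT0).2 hT.2
  have hk : 0 < k1 μ T := by
    rw [k1_eq_distSymbol_inv μ hT0]; exact distSymbol_pos μ hMpos (by positivity)
  have hbound : ∀ τ ∈ Set.Ioc 0 T,
      lker μ τ ^ p ≤ (B * Q * T ^ (-γ) / k1 μ T) ^ p * τ ^ ((γ - 1) * p) := by
    intro τ hτ
    have hτ0 := hτ.1
    have hτT : T⁻¹ ≤ τ⁻¹ := inv_anti₀ hτ0 hτ.2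
    have hKτ := distSymbol_pos μ hMpos (inv_pos.2 hτ0)
    have hmono := distSymbol_le_of_le μ hγ hγμ (hr₀.trans hT1) hτT
    rw [← k1_eq_distSymbol_inv μ hT0, ← hQ, inv_div_inv, Real.div_rpow hT0.le hτ0.le] at hmono
    have h1 : lker μ τ ≤ B * Q * T ^ (-γ) / k1 μ T * τ ^ (γ - 1) := by
      have h2 := hl τ⁻¹ (hT1.trans hτT)
      rw [inv_inv] at h2
      refine h2.trans ?_
      have hTγ : 0 < T ^ γ := Real.rpow_pos_of_pos hT0 _
      have hτγ : 0 < τ ^ γ := Real.rpow_pos_of_pos hτ0 _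
      rw [Real.rpow_neg hT0.le, Real.rpow_sub hτ0, Real.rpow_one]
      have h3 : (distSymbol μ τ⁻¹)⁻¹ ≤ Q * (τ ^ γ / (T ^ γ * k1 μ T)) := by
        rw [inv_le_iff_one_le_mul₀ hKτ]
        calc (1:ℝ) = T ^ γ / τ ^ γ * k1 μ T * (τ ^ γ / (T ^ γ * k1 μ T)) := by field_simp
          _ ≤ Q * distSymbol μ τ⁻¹ * (τ ^ γ / (T ^ γ * k1 μ T)) := by gcongr
          _ = _ := by ring
      calc B * (τ⁻¹ / distSymbol μ τ⁻¹) = B * τ⁻¹ * (distSymbol μ τ⁻¹)⁻¹ := by ring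
        _ ≤ B * τ⁻¹ * (Q * (τ ^ γ / (T ^ γ * k1 μ T))) := by gcongr
        _ = _ := by field_simp
    rw [Real.rpow_mul hτ0.le, ← Real.mul_rpow (by positivity) (by positivity)]
    exact Real.rpow_le_rpow (lker_nonneg μ τ) h1 hp0
  have hint : IntervalIntegrable
      (fun τ => (B * Q * T ^ (-γ) / k1 μ T) ^ p * τ ^ ((γ - 1) * p)) volume 0 T :=
    (intervalIntegral.intervalIntegrable_rpow' (by linarith)).const_mul _
  have hI : ∫ τ in (0:ℝ)..T, lker μ τ ^ p ≤
      (B * Q * T ^ (-γ) / k1 μ T) ^ p * (T ^ ((γ - 1) * p + 1) / ((γ - 1) * p + 1)) := by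
    calc ∫ τ in (0:ℝ)..T, lker μ τ ^ p ≤
          ∫ τ in (0:ℝ)..T, (B * Q * T ^ (-γ) / k1 μ T) ^ p * τ ^ ((γ - 1) * p) := by
          rw [intervalIntegral.integral_of_le hT0.le, intervalIntegral.integral_of_le hT0.le]
          refine integral_mono_of_nonneg
            (ae_of_all _ fun τ => Real.rpow_nonneg (lker_nonneg μ τ) _)
            ((intervalIntegrable_iff_integrableOn_Ioc_of_le hT0.le).1 hint) ?_
          filter_upwards [ae_restrict_mem measurableSet_Ioc] with τ hτ using hbound τ hτ
      _ = _ := by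
          rw [intervalIntegral.integral_const_mul, integral_rpow (Or.inl (by linarith)),
            Real.zero_rpow hs.ne', sub_zero]
  calc (∫ τ in (0:ℝ)..T, lker μ τ ^ p) * T ^ (p - 1) ≤
        (B * Q * T ^ (-γ) / k1 μ T) ^ p * (T ^ ((γ - 1) * p + 1) / ((γ - 1) * p + 1)) *
          T ^ (p - 1) := by gcongr
    _ = (B * Q) ^ p / ((γ - 1) * p + 1) * k1 μ T ^ (-p) *
          (T ^ (-γ * p) * T ^ ((γ - 1) * p + 1) * T ^ (p - 1)) := by
        rw [Real.div_rpow (by positivity) hk.le, Real.mul_rpow (by positivity) (by positivity),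
          ← Real.rpow_mul hT0.le, Real.rpow_neg hk.le]
        ring
    _ = _ := by
        rw [← Real.rpow_add hT0, ← Real.rpow_add hT0,
          show -γ * p + ((γ - 1) * p + 1) + (p - 1) = 0 by ring, Real.rpow_zero, mul_one]

/-- For every `p` with `1 ≤ p < 1/(1−γ₋)` there exist `r* = r*(μ,p) > 0` and `C = C(μ,p) > 0`
such that `Φ(2r*) ≤ 1` and for every `r ∈ (0, r*]`,
`(∫₀^{Φ(2r)} l(τ)^p dτ) · Φ(2r)^{p−1} ≤ C r^{2p}`. -/
theorem statement10 (μ : Measure ℝ) [IsFiniteMeasure μ] (hμ : IsDistOrderMeasure μ)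
    (γ : ℝ) (hγ : γ ∈ Set.Ioo (0:ℝ) 1) (hγμ : 0 < μ (Set.Ioc γ 1))
    (Φ : ℝ → ℝ) (hΦmono : StrictMonoOn Φ (Set.Ici 0))
    (hΦcont : ContinuousOn Φ (Set.Ici 0)) (hΦ0 : Φ 0 = 0)
    (hΦk1 : ∀ r > (0:ℝ), k1 μ (Φ r) = r ^ (-2 : ℝ))
    (p : ℝ) (hp1 : 1 ≤ p) (hp2 : p < 1 / (1 - γ)) :
    ∃ rs : ℝ, 0 < rs ∧ ∃ C : ℝ, 0 < C ∧ Φ (2 * rs) ≤ 1 ∧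
      ∀ r ∈ Set.Ioc (0:ℝ) rs,
        (∫ τ in (0:ℝ)..(Φ (2 * r)), (lker μ τ) ^ p) * (Φ (2 * r)) ^ (p - 1) ≤
          C * r ^ (2 * p) := by
  have hγμ' : 0 < μ.real (Set.Ioc γ 1) := ENNReal.toReal_pos hγμ.ne' (measure_ne_top _ _)
  have hp : p * (1 - γ) < 1 := (lt_div_iff₀ (by linarith [hγ.2])).1 hp2
  obtain ⟨t₀, ht₀, ht₀1, C, hC, hbound⟩ :=
    exists_integral_lker_rpow_le μ hγ hγμ' (by linarith) hp
  have hev : ∀ᶠ r in nhdsWithin (0:ℝ) (Set.Ici 0), Φ r < t₀ :=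
    (hΦcont 0 Set.self_mem_Ici).eventually_lt_const (by rwa [hΦ0])
  obtain ⟨u, hu, hΦu⟩ := mem_nhdsGE_iff_exists_Icc_subset.1 hev
  have hu0 : 0 < u := hu
  have hΦu' : Φ u < t₀ := hΦu ⟨hu0.le, le_rfl⟩
  refine ⟨u / 2, by positivity, C * 2 ^ (2 * p), by positivity, ?_, fun r hr => ?_⟩
  · rw [mul_div_cancel₀ u two_ne_zero]
    exact hΦu'.le.trans ht₀1
  · have hr0 : 0 < 2 * r := by linarith [hr.1]
    have hT0 : 0 < Φ (2 * r) := hΦ0 ▸ hΦmono Set.self_mem_Ici hr0.le hr0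
    have hT1 : Φ (2 * r) ≤ t₀ := (hΦu ⟨hr0.le, by linarith [hr.2]⟩ : Φ (2 * r) < t₀).le
    refine (hbound _ ⟨hT0, hT1⟩).trans_eq ?_
    rw [hΦk1 _ hr0, ← Real.rpow_mul hr0.le, Real.mul_rpow zero_le_two hr.1.le,
      show (-2 : ℝ) * -p = 2 * p by ring, mul_assoc]
end

section
/- Let T > 0, let k be absolutely continuous on [0,T] with derivative k̇ ∈ L₁((0,T)), let v ∈ L₁((0,T)), and let φ ∈ C¹([0,T]). Then for almost every t ∈ (0,T) the derivatives below exist and φ(t) · (d/dt)(k ∗ v)(t) = (d/dt)( k ∗ [φ v] )(t) + ∫₀ᵗ k̇(t−τ) ( φ(t) − φ(τ) ) v(τ) dτ. -/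
open MeasureTheory Real intervalIntegral

/-- The convolution on `(0, s)` of an absolutely continuous `k` with an integrable `w` is
`∫ (k 0 w + k' ∗ w)`, where `k'` and `w` are extended by zero outside `(0, T]`. -/
theorem integral_comp_sub_mul_eq {T : ℝ} {k k' w : ℝ → ℝ}
    (hk' : IntegrableOn k' (Set.Ioc 0 T) volume)
    (hk : ∀ t ∈ Set.Icc (0:ℝ) T, k t = k 0 + ∫ s in (0:ℝ)..t, k' s)
    (hw : IntegrableOn w (Set.Ioc 0 T) volume) {s : ℝ} (hs : s ∈ Set.Ioo 0 T) :
    ∫ τ in (0:ℝ)..s, k (s - τ) * w τ =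
      ∫ r in (0:ℝ)..s, (k 0 * (Set.Ioc 0 T).indicator w r +
        ∫ τ, (Set.Ioc 0 T).indicator w τ * (Set.Ioc 0 T).indicator k' (r - τ)) := by
  set f := (Set.Ioc 0 T).indicator w with hf
  set g := (Set.Ioc 0 T).indicator k' with hg
  have hfi : Integrable f := hw.integrable_indicator measurableSet_Ioc
  have hgi : Integrable g := hk'.integrable_indicator measurableSet_Ioc
  have hprod : Integrable (fun p : ℝ × ℝ => f p.2 * g (p.1 - p.2)) (volume.prod volume) :=
    hfi.convolution_integrand (ContinuousLinearMap.mul ℝ ℝ) hgi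
  have hprod_s : Integrable (fun p : ℝ × ℝ => f p.2 * g (p.1 - p.2))
      ((volume.restrict (Set.Ioc 0 s)).prod volume) :=
    hprod.mono_measure (Measure.prod_mono Measure.restrict_le_self le_rfl)
  have hg_nonpos : ∀ x ≤ 0, g x = 0 := fun x hx =>
    Set.indicator_of_notMem (fun h => absurd h.1 (not_lt.2 hx)) _
  have hinner : ∀ τ, ∫ r in Set.Ioc 0 s, f τ * g (r - τ) =
      (Set.Ioc 0 s).indicator (fun τ => k (s - τ) * w τ - k 0 * w τ) τ := by
    intro τ
    rw [MeasureTheory.integral_const_mul]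
    by_cases hτ0 : 0 < τ
    swap
    · rw [hf, Set.indicator_of_notMem (fun h => hτ0 h.1),
        Set.indicator_of_notMem (fun h => hτ0 h.1), zero_mul]
    by_cases hτs : τ ≤ s
    · have hG : ∫ r in Set.Ioc 0 s, g (r - τ) = k (s - τ) - k 0 := by
        rw [← intervalIntegral.integral_of_le hs.1.le, intervalIntegral.integral_comp_sub_right g,
          ← intervalIntegral.integral_add_adjacent_intervals (b := 0)
            hgi.intervalIntegrable hgi.intervalIntegrable,
          hk (s - τ) ⟨sub_nonneg.2 hτs, by linarith [hs.2]⟩]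
        have h₁ : ∫ x in (0 - τ)..0, g x = 0 := by
          rw [intervalIntegral.integral_congr (g := fun _ => (0 : ℝ)), intervalIntegral.integral_zero]
          intro x hx
          rw [Set.uIcc_of_le (by linarith)] at hx
          exact hg_nonpos x hx.2
        have h₂ : ∫ x in (0:ℝ)..(s - τ), g x = ∫ x in (0:ℝ)..(s - τ), k' x := by
          rw [intervalIntegral.integral_of_le (sub_nonneg.2 hτs),
            intervalIntegral.integral_of_le (sub_nonneg.2 hτs)]
          refine setIntegral_congr_fun measurableSet_Ioc fun x hx => ?_
          exact Set.indicator_of_mem (s := Set.Ioc 0 T) (a := x) ⟨hx.1, by linarith [hx.2, hs.2]⟩ _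
        rw [h₁, h₂]
        ring
      rw [hG, hf, Set.indicator_of_mem (s := Set.Ioc 0 T) (a := τ) ⟨hτ0, hτs.trans hs.2.le⟩,
        Set.indicator_of_mem (s := Set.Ioc 0 s) (a := τ) ⟨hτ0, hτs⟩]
      ring
    · rw [Set.indicator_of_notMem (s := Set.Ioc 0 s) (fun h => hτs h.2),
        setIntegral_congr_fun (g := fun _ => (0 : ℝ)) measurableSet_Ioc, MeasureTheory.integral_zero,
        mul_zero]
      intro r hr
      exact hg_nonpos _ (by linarith [hr.2])
  have hcor : IntegrableOn (fun τ => k (s - τ) * w τ - k 0 * w τ) (Set.Ioc 0 s) := by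
    rw [← integrable_indicator_iff measurableSet_Ioc]
    exact hprod_s.integral_prod_right.congr (Filter.Eventually.of_forall hinner)
  have hws : IntegrableOn w (Set.Ioc 0 s) := hw.mono_set (Set.Ioc_subset_Ioc_right hs.2.le)
  have hfw : ∫ r in Set.Ioc 0 s, k 0 * f r = ∫ r in Set.Ioc 0 s, k 0 * w r := by
    refine setIntegral_congr_fun measurableSet_Ioc fun x hx => ?_
    simp only [hf, Set.indicator_of_mem (show x ∈ Set.Ioc 0 T from ⟨hx.1, hx.2.trans hs.2.le⟩)]
  rw [intervalIntegral.integral_of_le hs.1.le, intervalIntegral.integral_of_le hs.1.le,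
    MeasureTheory.integral_add (hfi.integrableOn.const_mul _) hprod_s.integral_prod_left,
    MeasureTheory.integral_integral_swap hprod_s, integral_congr_ae (.of_forall hinner),
    MeasureTheory.integral_indicator measurableSet_Ioc, hfw,
    ← MeasureTheory.integral_add (hws.const_mul _) hcor]
  simp

/-- The convolution of an absolutely continuous `k` with an integrable `w` is almost everywhere
differentiable with derivative `k 0 w + k' ∗ w`. -/
theorem ae_hasDerivAt_integral_comp_sub_mul {T : ℝ} {k k' w : ℝ → ℝ}
    (hk' : IntegrableOn k' (Set.Ioc 0 T) volume)
    (hk : ∀ t ∈ Set.Icc (0:ℝ) T, k t = k 0 + ∫ s in (0:ℝ)..t, k' s)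
    (hw : IntegrableOn w (Set.Ioc 0 T) volume) :
    ∀ᵐ t ∂(volume.restrict (Set.Ioo 0 T)),
      IntervalIntegrable (fun τ => k' (t - τ) * w τ) volume 0 t ∧
      HasDerivAt (fun s => ∫ τ in (0:ℝ)..s, k (s - τ) * w τ)
        (k 0 * w t + ∫ τ in (0:ℝ)..t, k' (t - τ) * w τ) t := by
  have hfi : Integrable ((Set.Ioc 0 T).indicator w) := hw.integrable_indicator measurableSet_Ioc
  have hgi : Integrable ((Set.Ioc 0 T).indicator k') := hk'.integrable_indicator measurableSet_Ioc
  have hprod : Integrable (fun p : ℝ × ℝ => (Set.Ioc 0 T).indicator w p.2 *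
      (Set.Ioc 0 T).indicator k' (p.1 - p.2)) (volume.prod volume) :=
    hfi.convolution_integrand (ContinuousLinearMap.mul ℝ ℝ) hgi
  have hderiv := LocallyIntegrable.ae_hasDerivAt_integral
    ((hfi.const_mul (k 0)).add hprod.integral_prod_left).locallyIntegrable
  rw [ae_restrict_iff' measurableSet_Ioo]
  filter_upwards [hprod.prod_right_ae, hderiv] with t hint hder ht
  have hslice : (fun τ => (Set.Ioc 0 T).indicator w τ * (Set.Ioc 0 T).indicator k' (t - τ)) =
      (Set.Ioo 0 t).indicator fun τ => k' (t - τ) * w τ := by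
    ext τ
    by_cases hτ : τ ∈ Set.Ioo 0 t
    · rw [Set.indicator_of_mem hτ, Set.indicator_of_mem (s := Set.Ioc 0 T) ⟨hτ.1, by linarith [hτ.2, ht.2]⟩,
        Set.indicator_of_mem (s := Set.Ioc 0 T) ⟨by linarith [hτ.2], by linarith [hτ.1, ht.2]⟩, mul_comm]
    · rw [Set.indicator_of_notMem hτ]
      by_cases hτ0 : 0 < τ
      · rw [Set.indicator_of_notMem (s := Set.Ioc 0 T) (a := t - τ)
          (fun h => hτ ⟨hτ0, by linarith [h.1]⟩), mul_zero]
      · rw [Set.indicator_of_notMem (fun h => hτ0 h.1), zero_mul]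
  refine ⟨?_, ?_⟩
  · rw [intervalIntegrable_iff_integrableOn_Ioo_of_le ht.1.le,
      ← integrable_indicator_iff measurableSet_Ioo, ← hslice]
    exact hint
  · have hd := hder 0
    simp only [Pi.add_apply] at hd
    rw [hslice, MeasureTheory.integral_indicator measurableSet_Ioo, ← integral_Ioc_eq_integral_Ioo,
      ← intervalIntegral.integral_of_le ht.1.le,
      Set.indicator_of_mem (s := Set.Ioc 0 T) (a := t) ⟨ht.1, ht.2.le⟩] at hd
    refine hd.congr_of_eventuallyEq ?_
    filter_upwards [isOpen_Ioo.mem_nhds ht] with s hs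
    exact integral_comp_sub_mul_eq hk' hk hw hs

/-- Commutation identity for integro-differential operators. Let `T > 0`, let `k` be
absolutely continuous on `[0,T]` with derivative `k' ∈ L₁((0,T))`, let `v ∈ L₁((0,T))`, and
let `φ ∈ C¹([0,T])`. Then for a.e. `t ∈ (0,T)` the derivatives of `k ∗ v` and `k ∗ [φ v]`
exist at `t` and
`φ(t) (d/dt)(k ∗ v)(t) = (d/dt)(k ∗ [φ v])(t) + ∫₀ᵗ k̇(t−τ)(φ(t)−φ(τ)) v(τ) dτ`,
where `(f ∗ g)(t) = ∫₀ᵗ f(t−τ) g(τ) dτ`. -/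
theorem statement18 (T : ℝ) (hT : 0 < T)
    (k k' v φ : ℝ → ℝ)
    (hk' : IntegrableOn k' (Set.Ioc 0 T) volume)
    (hk : ∀ t ∈ Set.Icc (0:ℝ) T, k t = k 0 + ∫ s in (0:ℝ)..t, k' s)
    (hv : IntegrableOn v (Set.Ioc 0 T) volume)
    (hφ : ContDiffOn ℝ 1 φ (Set.Icc 0 T)) :
    ∀ᵐ t ∂(volume.restrict (Set.Ioo 0 T)),
      ∃ D₁ D₂ : ℝ,
        HasDerivAt (fun s => ∫ τ in (0:ℝ)..s, k (s - τ) * v τ) D₁ t ∧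
        HasDerivAt (fun s => ∫ τ in (0:ℝ)..s, k (s - τ) * (φ τ * v τ)) D₂ t ∧
        φ t * D₁ = D₂ + ∫ τ in (0:ℝ)..t, k' (t - τ) * (φ t - φ τ) * v τ := by
  have hφv : IntegrableOn (fun τ => φ τ * v τ) (Set.Ioc 0 T) := by
    rw [← integrableOn_Icc_iff_integrableOn_Ioc] at hv ⊢
    exact hv.continuousOn_mul hφ.continuousOn isCompact_Icc
  filter_upwards [ae_hasDerivAt_integral_comp_sub_mul hk' hk hv,
    ae_hasDerivAt_integral_comp_sub_mul hk' hk hφv] with t ⟨hi₁, hd₁⟩ ⟨hi₂, hd₂⟩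
  refine ⟨_, _, hd₁, hd₂, ?_⟩
  have hsplit : ∫ τ in (0:ℝ)..t, k' (t - τ) * (φ t - φ τ) * v τ =
      φ t * (∫ τ in (0:ℝ)..t, k' (t - τ) * v τ) -
        ∫ τ in (0:ℝ)..t, k' (t - τ) * (φ τ * v τ) := by
    rw [← intervalIntegral.integral_const_mul,
      ← intervalIntegral.integral_sub (hi₁.const_mul _) hi₂]
    congr 1
    ext τ
    ring
  rw [hsplit]
  ring
end
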